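/- arXiv:2509.02832 — 3 statements merged into one kernel-verified Lean document; each statement's English description precedes it below -/
import Mathlib

section
/- Let M be a matroid on E = {1,...,n} with set of circuits 𝒞, and let C be a circuit of M. Then the winning probability of C in matroid bingo satisfies β_C = Σ_{k=0}^{|𝒞|-1} (-1)^k · Σ_{S ⊆ 𝒞\{C}, |S| = k} |C| / |(∪_{C' ∈ S} C') ∪ C|. -/
open Finset

/-- A matroid presented by its collection of circuits (the valid sets of bingo
cards): nonempty ground set axioms (C1)-(C3) of the paper. -/
structure BingoMatroid (α : Type*) [DecidableEq α] where
  /-- the ground set -/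
  E : Finset α
  /-- the circuits (bingo cards) -/
  circuits : Finset (Finset α)
  subset_ground : ∀ C ∈ circuits, C ⊆ E
  empty_not_mem : ∅ ∉ circuits
  antichain : ∀ C₁ ∈ circuits, ∀ C₂ ∈ circuits, C₁ ⊆ C₂ → C₁ = C₂
  elimination : ∀ C₁ ∈ circuits, ∀ C₂ ∈ circuits, C₁ ≠ C₂ →
    ∀ e ∈ C₁ ∩ C₂, ∃ C₃ ∈ circuits, C₃ ⊆ (C₁ ∪ C₂) \ {e}

/-- The completion time `t_C(σ)`: the least `t` such that every element of `C`
has been called out among the first `t` values of `σ`. -/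
noncomputable def hitTime {α : Type*} {n : ℕ} (σ : Fin n → α) (C : Finset α) : ℕ :=
  sInf {t : ℕ | ∀ x ∈ C, ∃ i : Fin n, (i : ℕ) < t ∧ σ i = x}

namespace BingoMatroid

variable {α : Type*} [DecidableEq α]

/-- `C` wins the bingo game under calling order `σ`: it is completed strictly
before every other circuit. -/
def Wins (M : BingoMatroid α) (σ : Fin M.E.card ≃ {x // x ∈ M.E}) (C : Finset α) : Prop :=
  ∀ C' ∈ M.circuits, C' ≠ C →
    hitTime (fun i => (σ i : α)) C < hitTime (fun i => (σ i : α)) C'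

/-- The winning probability `β_C`: the number of calling orders under which `C`
wins, divided by `n!`. -/
noncomputable def beta (M : BingoMatroid α) (C : Finset α) : ℚ :=
  (Nat.card {σ : Fin M.E.card ≃ {x // x ∈ M.E} // M.Wins σ C} : ℚ) /
    (Nat.factorial M.E.card : ℚ)

/-- The timed winning probability `β_C(t)`: the probability that `C` wins and is
completed exactly in round `t`. -/
noncomputable def betaT (M : BingoMatroid α) (C : Finset α) (t : ℕ) : ℚ :=
  (Nat.card {σ : Fin M.E.card ≃ {x // x ∈ M.E} //
      M.Wins σ C ∧ hitTime (fun i => (σ i : α)) C = t} : ℚ) /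
    (Nat.factorial M.E.card : ℚ)

/-- A set is independent if it is contained in the ground set and contains no circuit. -/
def Indep (M : BingoMatroid α) (I : Finset α) : Prop :=
  I ⊆ M.E ∧ ∀ C ∈ M.circuits, ¬ C ⊆ I

/-- The rank of the matroid: the maximum size of an independent set. -/
noncomputable def rank (M : BingoMatroid α) : ℕ :=
  sSup {k : ℕ | ∃ I : Finset α, M.Indep I ∧ I.card = k}

/-- A basis is a maximal independent set. -/
def IsBase (M : BingoMatroid α) (B : Finset α) : Prop :=
  M.Indep B ∧ ∀ J : Finset α, M.Indep J → B ⊆ J → B = J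

/-- A coloop is an element of the ground set contained in no circuit. -/
def IsColoop (M : BingoMatroid α) (e : α) : Prop :=
  e ∈ M.E ∧ ∀ C ∈ M.circuits, e ∉ C

/-- `D` is a circuit of the contraction `M/T`: a nonempty inclusion-minimal
member of `{C \ T : C a circuit of M}`. -/
def IsContractCircuit (M : BingoMatroid α) (T D : Finset α) : Prop :=
  D.Nonempty ∧ (∃ C ∈ M.circuits, D = C \ T) ∧
    ∀ C' ∈ M.circuits, (C' \ T).Nonempty → ¬ (C' \ T) ⊂ D

end BingoMatroid

/-- Any element of a nonempty set `U` comes last among `U` in the same number of orderings. -/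
lemma card_filter_isLast_mul_card {β : Type*} [Fintype β] [DecidableEq β] {n : ℕ}
    (U : Finset β) {u : β} (hu : u ∈ U) :
    #{σ : Fin n ≃ β | ∀ x ∈ U, σ.symm x ≤ σ.symm u} * #U = Fintype.card (Fin n ≃ β) := by
  have hsymm : ∀ v ∈ U, #{σ : Fin n ≃ β | ∀ x ∈ U, σ.symm x ≤ σ.symm v} =
      #{σ : Fin n ≃ β | ∀ x ∈ U, σ.symm x ≤ σ.symm u} := by
    intro v hv
    have hswap : ∀ x ∈ U, Equiv.swap u v x ∈ U := by
      intro x hx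
      rw [Equiv.swap_apply_def]
      split_ifs <;> assumption
    refine Finset.card_bij' (fun σ _ => σ.trans (Equiv.swap u v))
      (fun σ _ => σ.trans (Equiv.swap u v)) ?_ ?_ ?_ ?_
    · intro σ hσ
      simp only [mem_filter, mem_univ, true_and] at hσ ⊢
      intro x hx
      simpa using hσ _ (hswap x hx)
    · intro σ hσ
      simp only [mem_filter, mem_univ, true_and] at hσ ⊢
      intro x hx
      simpa using hσ _ (hswap x hx)
    · intro σ _
      ext; simp
    · intro σ _
      ext; simp
  rw [mul_comm, ← smul_eq_mul, ← Finset.sum_const, ← Finset.sum_congr rfl hsymm,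
    ← Finset.card_biUnion, ← Finset.card_univ]
  · congr 1
    ext σ
    obtain ⟨v, hv, hmax⟩ := U.exists_max_image σ.symm ⟨u, hu⟩
    simp only [mem_biUnion, mem_filter, mem_univ, true_and, iff_true]
    exact ⟨v, hv, hmax⟩
  · intro v hv w hw hvw
    simp only [Function.onFun, Finset.disjoint_left, mem_filter, mem_univ, true_and]
    intro σ h₁ h₂
    exact hvw (σ.symm.injective (le_antisymm (h₂ v hv) (h₁ w hw)))

/-- The number of orderings in which the last element of `U` lies in `A ⊆ U`. -/
lemma card_filter_exists_isLast_mul_card {β : Type*} [Fintype β] [DecidableEq β] {n : ℕ}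
    {A U : Finset β} (hAU : A ⊆ U) :
    #{σ : Fin n ≃ β | ∃ u ∈ A, ∀ x ∈ U, σ.symm x ≤ σ.symm u} * #U =
      #A * Fintype.card (Fin n ≃ β) := by
  have hunion : ({σ : Fin n ≃ β | ∃ u ∈ A, ∀ x ∈ U, σ.symm x ≤ σ.symm u} : Finset _) =
      A.biUnion fun u => {σ : Fin n ≃ β | ∀ x ∈ U, σ.symm x ≤ σ.symm u} := by
    ext; simp
  rw [hunion, Finset.card_biUnion, Finset.sum_mul,
    Finset.sum_congr rfl fun u hu => card_filter_isLast_mul_card U (hAU hu), Finset.sum_const,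
    smul_eq_mul]
  intro v hv w hw hvw
  simp only [Function.onFun, Finset.disjoint_left, mem_filter, mem_univ, true_and]
  intro σ h₁ h₂
  exact hvw (σ.symm.injective (le_antisymm (h₂ v (hAU hv)) (h₁ w (hAU hw))))

section hitTime

variable {α : Type*} {E : Finset α} {n : ℕ} (σ : Fin n ≃ {x // x ∈ E})

/-- `C` is completed by time `t` iff each of its elements is called before time `t`. -/
lemma hitTime_le_iff {C : Finset α} (hC : C ⊆ E) (t : ℕ) :
    hitTime (fun i => (σ i : α)) C ≤ t ↔
      ∀ x : {x // x ∈ E}, (x : α) ∈ C → (σ.symm x : ℕ) < t := by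
  have hset : {t : ℕ | ∀ x ∈ C, ∃ i : Fin n, (i : ℕ) < t ∧ (σ i : α) = x} =
      {t : ℕ | ∀ x : {x // x ∈ E}, (x : α) ∈ C → (σ.symm x : ℕ) < t} := by
    ext s
    constructor
    · intro h x hx
      obtain ⟨i, hi, hix⟩ := h x hx
      rwa [← Subtype.ext hix, σ.symm_apply_apply]
    · intro h x hx
      exact ⟨σ.symm ⟨x, hC hx⟩, h ⟨x, hC hx⟩ hx, by simp⟩
  rw [hitTime, hset]
  constructor
  · intro h x hx
    have hmem := Nat.sInf_mem
      (s := {t : ℕ | ∀ x : {x // x ∈ E}, (x : α) ∈ C → (σ.symm x : ℕ) < t})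
      ⟨n, fun x _ => (σ.symm x).isLt⟩
    exact (hmem x hx).trans_le h
  · exact fun h => Nat.sInf_le h

/-- All cards in `S` are completed no later than `C` iff the last element called from their
union with `C` lies in `C`. -/
lemma forall_hitTime_le_iff [DecidableEq α] {C : Finset α} (hC : C ⊆ E) (hne : C.Nonempty)
    {S : Finset (Finset α)} (hS : ∀ D ∈ S, D ⊆ E) :
    (∀ D ∈ S, hitTime (fun i => (σ i : α)) D ≤ hitTime (fun i => (σ i : α)) C) ↔
      ∃ u ∈ C.subtype (· ∈ E), ∀ x ∈ (S.sup id ∪ C).subtype (· ∈ E),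
        σ.symm x ≤ σ.symm u := by
  obtain ⟨c, hc⟩ := hne
  have hlt : ∀ p : ℕ, p < hitTime (fun i => (σ i : α)) C ↔
      ∃ u : {x // x ∈ E}, (u : α) ∈ C ∧ p ≤ σ.symm u := by
    intro p
    rw [← not_le, hitTime_le_iff σ hC]
    push Not
    rfl
  simp only [mem_subtype, mem_union, Finset.mem_sup, id]
  constructor
  · intro h
    obtain ⟨u, hu, hmax⟩ := (C.subtype (· ∈ E)).exists_max_image σ.symm
      ⟨⟨c, hC hc⟩, by simpa using hc⟩
    simp only [mem_subtype] at hu hmax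
    refine ⟨u, hu, ?_⟩
    rintro x (⟨D, hD, hx⟩ | hx)
    · obtain ⟨v, hv, hxv⟩ := (hlt _).1 ((hitTime_le_iff σ (hS D hD) _).1 (h D hD) x hx)
      exact le_trans (Fin.le_def.2 hxv) (hmax v hv)
    · exact hmax x hx
  · rintro ⟨u, hu, hmax⟩ D hD
    rw [hitTime_le_iff σ (hS D hD)]
    exact fun x hx => (hlt _).2 ⟨u, hu, hmax x (Or.inl ⟨D, hD, hx⟩)⟩

end hitTime

/-- Inclusion–exclusion for the number of points satisfying none of the properties indexed
by `s`. -/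
lemma card_filter_forall_not {ι κ : Type*} [Fintype κ] (s : Finset ι) (P : ι → κ → Prop)
    [∀ i, DecidablePred (P i)] :
    (#{a : κ | ∀ i ∈ s, ¬ P i a} : ℚ) =
      ∑ t ∈ s.powerset, (-1 : ℚ) ^ #t * #{a : κ | ∀ i ∈ t, P i a} := by
  classical
  have hprod : ∀ a : κ, (if ∀ i ∈ s, ¬ P i a then (1 : ℚ) else 0) =
      ∑ t ∈ s.powerset, (-1 : ℚ) ^ #t * if ∀ i ∈ t, P i a then 1 else 0 := by
    intro a
    have hfactor : (if ∀ i ∈ s, ¬ P i a then (1 : ℚ) else 0) =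
        ∏ i ∈ s, (1 + -(if P i a then (1 : ℚ) else 0)) := by
      rw [← Finset.prod_boole]
      refine Finset.prod_congr rfl fun i _ => ?_
      split_ifs <;> simp_all
    rw [hfactor, Finset.prod_one_add]
    refine Finset.sum_congr rfl fun t _ => ?_
    rw [Finset.prod_neg, Finset.prod_boole]
  rw [← Finset.sum_boole, Finset.sum_congr rfl fun a _ => hprod a, Finset.sum_comm]
  refine Finset.sum_congr rfl fun t _ => ?_
  rw [← Finset.mul_sum, Finset.sum_boole]

/-- inclusion-exclusion formula for the winning probability `β_C`. -/
theorem stmt0 {α : Type*} [DecidableEq α] (M : BingoMatroid α) (hE : M.E.Nonempty)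
    (C : Finset α) (hC : C ∈ M.circuits) :
    M.beta C = ∑ k ∈ Finset.range M.circuits.card, (-1 : ℚ) ^ k *
      ∑ S ∈ (M.circuits.erase C).powersetCard k,
        (C.card : ℚ) / ((S.sup id ∪ C).card : ℚ) := by
  classical
  have hCE := M.subset_ground C hC
  have hne : C.Nonempty :=
    Finset.nonempty_iff_ne_empty.2 fun h => M.empty_not_mem (h ▸ hC)
  have hcount : ∀ S ∈ (M.circuits.erase C).powerset,
      (#{σ : Fin M.E.card ≃ {x // x ∈ M.E} | ∀ D ∈ S,
        hitTime (fun i => (σ i : α)) D ≤ hitTime (fun i => (σ i : α)) C} : ℚ) /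
          (Nat.factorial M.E.card : ℚ) = (#C : ℚ) / (#(S.sup id ∪ C) : ℚ) := by
    intro S hS
    have hSE : ∀ D ∈ S, D ⊆ M.E := fun D hD =>
      M.subset_ground D (Finset.mem_of_mem_erase (Finset.mem_powerset.1 hS hD))
    have hUE : S.sup id ∪ C ⊆ M.E := Finset.union_subset (Finset.sup_le hSE) hCE
    have hcard : ∀ A ⊆ M.E, #(A.subtype (· ∈ M.E)) = #A := fun A hA => by
      rw [Finset.card_subtype, Finset.filter_true_of_mem fun x hx => hA hx]
    have hU : (#(S.sup id ∪ C) : ℚ) ≠ 0 := by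
      exact_mod_cast (Finset.card_pos.2 (hne.mono Finset.subset_union_right)).ne'
    have hlast := card_filter_exists_isLast_mul_card (n := M.E.card)
      (A := C.subtype (· ∈ M.E)) (U := (S.sup id ∪ C).subtype (· ∈ M.E))
      (Finset.subtype_mono Finset.subset_union_right)
    rw [hcard _ hCE, hcard _ hUE, Fintype.card_equiv M.E.equivFin.symm, Fintype.card_fin] at hlast
    simp_rw [forall_hitTime_le_iff _ hCE hne hSE]
    rw [div_eq_div_iff (by exact_mod_cast Nat.factorial_ne_zero _) hU]
    exact_mod_cast hlast
  have hwins : Nat.card {σ : Fin M.E.card ≃ {x // x ∈ M.E} // M.Wins σ C} =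
      #{σ : Fin M.E.card ≃ {x // x ∈ M.E} | ∀ D ∈ M.circuits.erase C,
        ¬ hitTime (fun i => (σ i : α)) D ≤ hitTime (fun i => (σ i : α)) C} := by
    rw [Nat.card_eq_fintype_card, Fintype.card_subtype]
    congr 1
    ext σ
    simp only [BingoMatroid.Wins, mem_filter, mem_univ, true_and, mem_erase, not_le]
    grind
  rw [BingoMatroid.beta, hwins, card_filter_forall_not, Finset.sum_div,
    Finset.sum_congr rfl fun S hS => by rw [mul_div_assoc, hcount S hS], Finset.sum_powerset,
    Finset.card_erase_add_one hC]
  refine Finset.sum_congr rfl fun k _ => ?_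
  rw [Finset.mul_sum]
  refine Finset.sum_congr rfl fun S hS => ?_
  rw [(Finset.mem_powersetCard.1 hS).2]
end

section
/- Let M be a matroid of rank r on a ground set E of size n, and let C be a circuit of M. For each integer t with |C| ≤ t ≤ n, the timed winning probability satisfies β_C(t) = (|C|/n) · |𝓘_{C, t-|C|}| · binom(n-1, t-1)^{-1}, where 𝓘_{C,k} is the collection of all k-element subsets S of E \ C such that C is the unique circuit of M contained in S ∪ C. Moreover β_C(t) = 0 for t < |C| and for t > r + 1, so β_C = Σ_{t=|C|}^{r+1} β_C(t). -/
open Finset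

/-- The set of elements called out in the first `t` rounds. -/
def calledSet {α : Type*} [DecidableEq α] {n : ℕ} (σ : Fin n → α) (t : ℕ) : Finset α :=
  (univ.filter (fun i : Fin n => (i : ℕ) < t)).image σ

section CalledSet

variable {α : Type*} [DecidableEq α] {n : ℕ} {σ : Fin n → α} {C : Finset α} {t : ℕ}

lemma mem_calledSet {x : α} : x ∈ calledSet σ t ↔ ∃ i : Fin n, (i : ℕ) < t ∧ σ i = x := by
  simp [calledSet]

lemma hitTime_le_iff_s1 (hC : ∀ x ∈ C, ∃ i, σ i = x) : hitTime σ C ≤ t ↔ C ⊆ calledSet σ t := by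
  simp only [Finset.subset_iff, mem_calledSet]
  refine ⟨fun h x hx => ?_, fun h => Nat.sInf_le h⟩
  have hne : {t : ℕ | ∀ x ∈ C, ∃ i : Fin n, (i : ℕ) < t ∧ σ i = x}.Nonempty :=
    ⟨n, fun x hx => (hC x hx).imp fun i hi => ⟨i.2, hi⟩⟩
  obtain ⟨i, hi, rfl⟩ := Nat.sInf_mem hne x hx
  exact ⟨i, lt_of_lt_of_le hi h, rfl⟩

lemma hitTime_le_length (hC : ∀ x ∈ C, ∃ i, σ i = x) : hitTime σ C ≤ n :=
  (hitTime_le_iff_s1 hC).2 fun x hx => mem_calledSet.2 ((hC x hx).imp fun i hi => ⟨i.2, hi⟩)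

lemma card_calledSet (hσ : Function.Injective σ) (ht : t ≤ n) : (calledSet σ t).card = t := by
  rw [calledSet, card_image_of_injective _ hσ, Fin.card_filter_val_lt, min_eq_right ht]

lemma calledSet_succ (ht : t < n) :
    calledSet σ (t + 1) = insert (σ ⟨t, ht⟩) (calledSet σ t) := by
  ext x
  simp only [mem_insert, mem_calledSet]
  constructor
  · rintro ⟨i, hi, rfl⟩
    rcases Nat.lt_succ_iff_lt_or_eq.1 hi with h | h
    · exact Or.inr ⟨i, h, rfl⟩
    · exact Or.inl (congrArg σ (Fin.ext h))
  · rintro (rfl | ⟨i, hi, rfl⟩)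
    · exact ⟨_, Nat.lt_succ_self t, rfl⟩
    · exact ⟨i, hi.trans (Nat.lt_succ_self t), rfl⟩

lemma apply_notMem_calledSet (hσ : Function.Injective σ) (ht : t < n) :
    σ ⟨t, ht⟩ ∉ calledSet σ t := by
  rw [mem_calledSet]
  rintro ⟨i, hi, h⟩
  rw [hσ h] at hi
  exact lt_irrefl _ hi

lemma hitTime_eq_succ_iff (hσ : Function.Injective σ) (hC : ∀ x ∈ C, ∃ i, σ i = x) (ht : t < n) :
    hitTime σ C = t + 1 ↔ C ⊆ calledSet σ (t + 1) ∧ σ ⟨t, ht⟩ ∈ C := by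
  have h : hitTime σ C = t + 1 ↔ hitTime σ C ≤ t + 1 ∧ ¬ hitTime σ C ≤ t := by lia
  rw [h, hitTime_le_iff_s1 hC, hitTime_le_iff_s1 hC]
  refine and_congr_right fun hsub => ?_
  rw [calledSet_succ ht] at hsub
  constructor
  · intro hn
    by_contra hmem
    exact hn ((subset_insert_iff_of_notMem hmem).1 hsub)
  · exact fun hmem hn => apply_notMem_calledSet hσ ht (hn hmem)

end CalledSet

/-- The bijections intertwining two colourings with equinumerous colour classes are counted by
the product of the factorials of the sizes of the classes. -/
lemma card_equiv_comp_eq {A B ι : Type*} [Fintype A] [Fintype B] [Fintype ι] [DecidableEq A]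
    [DecidableEq B] [DecidableEq ι] (f : A → ι) (g : B → ι)
    (h : ∀ c, Fintype.card {a // f a = c} = Fintype.card {b // g b = c}) :
    Fintype.card {σ : A ≃ B // g ∘ σ = f} =
      ∏ c, (Fintype.card {a // f a = c}).factorial := by
  let σ₀ : A ≃ B := Equiv.ofFiberEquiv fun c => Fintype.equivOfCardEq (h c)
  have hσ₀ : ∀ a, g (σ₀ a) = f a := fun a => Equiv.ofFiberEquiv_map _ a
  rw [← DomMulAct.stabilizer_card f]
  refine Fintype.card_congr (((Equiv.refl A).equivCongr σ₀).subtypeEquiv fun π => ?_).symm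
  simp only [funext_iff, Function.comp_apply]
  exact forall_congr' fun a => by simp [hσ₀]

/-- The number of calling orders whose first `t + 1` calls form the set `T`, the last of them
being `c`. -/
lemma card_calledSet_eq {α : Type*} [DecidableEq α] {E T : Finset α} {c : α} {t : ℕ}
    (ht : t < E.card) (hT : T ⊆ E) (hcT : c ∈ T) (hcard : T.card = t + 1) :
    Fintype.card {σ : Fin E.card ≃ {x // x ∈ E} //
      calledSet (fun i => (σ i : α)) (t + 1) = T ∧ (σ ⟨t, ht⟩ : α) = c} =
      t.factorial * (E.card - (t + 1)).factorial := by
  let f : Fin E.card → Fin 3 := fun i => if (i : ℕ) < t then 0 else if (i : ℕ) = t then 1 else 2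
  let g : {x // x ∈ E} → Fin 3 := fun x => if (x : α) = c then 1 else if (x : α) ∈ T then 0 else 2
  have hf0 : Fintype.card {a // f a = 0} = t := by
    have h : ∀ a, f a = 0 ↔ (a : ℕ) < t := fun a => by
      simp only [f]; split_ifs <;> simp_all
    simp only [h, Fintype.card_subtype, Fin.card_filter_val_lt, min_eq_right ht.le]
  have hf1 : Fintype.card {a // f a = 1} = 1 := by
    have h : ∀ a, f a = 1 ↔ a = ⟨t, ht⟩ := fun a => by
      simp only [f, Fin.ext_iff (a := a)]; split_ifs <;> (simp_all; try lia)
    simp only [h, Fintype.card_subtype_eq]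
  have hf2 : Fintype.card {a // f a = 2} = E.card - (t + 1) := by
    have h := Fintype.card_congr (Equiv.sigmaFiberEquiv f)
    rw [Fintype.card_sigma, Fin.sum_univ_three, hf0, hf1, Fintype.card_fin] at h
    lia
  have hg0 : Fintype.card {a // g a = 0} = t := by
    rw [Fintype.card_subtype, ← card_image_of_injective _ Subtype.val_injective,
      ← Nat.add_sub_cancel (n := t) (m := 1), ← hcard, ← card_erase_of_mem hcT]
    congr 1
    ext x
    simp only [mem_image, mem_filter, mem_univ, true_and, mem_erase]
    constructor
    · rintro ⟨y, hy, rfl⟩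
      simp only [g] at hy
      split_ifs at hy <;> simp_all
    · rintro ⟨hx, hxT⟩
      exact ⟨⟨x, hT hxT⟩, by simp [g, hx, hxT], rfl⟩
  have hg1 : Fintype.card {a // g a = 1} = 1 := by
    have h : ∀ b, g b = 1 ↔ b = ⟨c, hT hcT⟩ := fun b => by
      simp only [g, Subtype.ext_iff]; split_ifs <;> simp_all
    simp only [h, Fintype.card_subtype_eq]
  have hg2 : Fintype.card {a // g a = 2} = E.card - (t + 1) := by
    have h := Fintype.card_congr (Equiv.sigmaFiberEquiv g)
    rw [Fintype.card_sigma, Fin.sum_univ_three, hg0, hg1, Fintype.card_coe] at h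
    lia
  have key := card_equiv_comp_eq f g (by
    intro c
    fin_cases c
    · exact hf0.trans hg0.symm
    · exact hf1.trans hg1.symm
    · exact hf2.trans hg2.symm)
  rw [Fin.prod_univ_three, hf0, hf1, hf2, Nat.factorial_one, mul_one] at key
  rw [← key]
  refine Fintype.card_congr (Equiv.subtypeEquivRight fun σ => ?_)
  have hinj : Function.Injective fun i => (σ i : α) := Subtype.val_injective.comp σ.injective
  rw [funext_iff]
  constructor
  · rintro ⟨h, h'⟩ i
    have h₁ : (σ i : α) = c ↔ (i : ℕ) = t := by
      rw [← h', hinj.eq_iff (a := i), Fin.ext_iff]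
    have h₂ : (σ i : α) ∈ T ↔ (i : ℕ) < t + 1 := by
      rw [← h, mem_calledSet]
      exact ⟨fun ⟨j, hj, hji⟩ => hinj hji ▸ hj, fun hi => ⟨i, hi, rfl⟩⟩
    simp only [Function.comp_apply, f, g, h₁, h₂]
    split_ifs <;> first | rfl | lia
  · intro h
    refine ⟨eq_of_subset_of_card_le (fun x hx => ?_) ?_, ?_⟩
    · obtain ⟨i, hi, rfl⟩ := mem_calledSet.1 hx
      have hi' := h i
      simp only [Function.comp_apply, f, g] at hi'
      by_contra hxT
      have hxc : (σ i : α) ≠ c := fun hc => hxT (hc ▸ hcT)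
      rw [if_neg hxc, if_neg hxT] at hi'
      split_ifs at hi' <;> lia
    · rw [hcard, card_calledSet hinj ht]
    · have ht' := h ⟨t, ht⟩
      simp only [Function.comp_apply, f, g, lt_irrefl, if_true, if_false] at ht'
      by_contra hc
      rw [if_neg hc] at ht'
      split_ifs at ht' <;> simp at ht'

namespace BingoMatroid

variable {α : Type*} [DecidableEq α] {M : BingoMatroid α} {C : Finset α} {t : ℕ}
  {σ : Fin M.E.card ≃ {x // x ∈ M.E}}

lemma coe_injective (σ : Fin M.E.card ≃ {x // x ∈ M.E}) :
    Function.Injective fun i => (σ i : α) :=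
  Subtype.val_injective.comp σ.injective

lemma exists_call_eq (σ : Fin M.E.card ≃ {x // x ∈ M.E}) (hC : C ∈ M.circuits) :
    ∀ x ∈ C, ∃ i, (σ i : α) = x :=
  fun x hx => ⟨σ.symm ⟨x, M.subset_ground C hC hx⟩, by simp⟩

lemma calledSet_subset_ground (σ : Fin M.E.card ≃ {x // x ∈ M.E}) (t : ℕ) :
    calledSet (fun i => (σ i : α)) t ⊆ M.E := by
  intro x hx
  obtain ⟨i, -, rfl⟩ := mem_calledSet.1 hx
  exact (σ i).2

lemma card_le_hitTime (σ : Fin M.E.card ≃ {x // x ∈ M.E}) (hC : C ∈ M.circuits) :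
    C.card ≤ hitTime (fun i => (σ i : α)) C := by
  have h := card_le_card ((hitTime_le_iff_s1 (exists_call_eq σ hC)).1 le_rfl)
  rwa [card_calledSet (coe_injective σ) (hitTime_le_length (exists_call_eq σ hC))] at h

lemma Indep.card_le_rank {I : Finset α} (hI : M.Indep I) : I.card ≤ M.rank := by
  refine le_csSup ⟨M.E.card, ?_⟩ ⟨I, hI, rfl⟩
  rintro _ ⟨J, hJ, rfl⟩
  exact card_le_card hJ.1

lemma Wins.hitTime_le (h : M.Wins σ C) (hC : C ∈ M.circuits) :
    hitTime (fun i => (σ i : α)) C ≤ M.rank + 1 := by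
  obtain hz | ⟨t, ht⟩ := (hitTime (fun i => (σ i : α)) C).eq_zero_or_eq_succ_pred.imp_right
    fun h => (⟨_, h⟩ : ∃ t, hitTime (fun i => (σ i : α)) C = t + 1)
  · lia
  have hn := hitTime_le_length (exists_call_eq σ hC)
  have hI : M.Indep (calledSet (fun i => (σ i : α)) t) := by
    refine ⟨calledSet_subset_ground σ t, fun C' hC' hsub => ?_⟩
    have hle := (hitTime_le_iff_s1 (exists_call_eq σ hC')).2 hsub
    by_cases hCC : C' = C
    · subst hCC
      lia
    · have := h C' hC' hCC
      lia
  have := hI.card_le_rank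
  rw [card_calledSet (coe_injective σ) (by lia)] at this
  lia

lemma wins_and_hitTime_eq_succ_iff (hC : C ∈ M.circuits) (ht : t < M.E.card) :
    M.Wins σ C ∧ hitTime (fun i => (σ i : α)) C = t + 1 ↔
      (∀ C' ∈ M.circuits, C' ⊆ calledSet (fun i => (σ i : α)) (t + 1) → C' = C) ∧
        C ⊆ calledSet (fun i => (σ i : α)) (t + 1) ∧ (σ ⟨t, ht⟩ : α) ∈ C := by
  rw [← hitTime_eq_succ_iff (coe_injective σ) (exists_call_eq σ hC) ht]
  refine and_congr_left fun h => ?_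
  refine forall₂_congr fun C' hC' => ?_
  rw [h, ← hitTime_le_iff_s1 (exists_call_eq σ hC'), ← not_le]
  tauto

lemma betaT_eq_zero (h : ∀ σ, M.Wins σ C → hitTime (fun i => (σ i : α)) C ≠ t) :
    M.betaT C t = 0 := by
  have : IsEmpty {σ : Fin M.E.card ≃ {x // x ∈ M.E} //
      M.Wins σ C ∧ hitTime (fun i => (σ i : α)) C = t} := ⟨fun σ => h σ.1 σ.2.1 σ.2.2⟩
  simp [betaT]

/-- The number of calling orders under which `C` wins in round `t + 1`. -/
lemma card_wins_and_hitTime_eq_succ (hC : C ∈ M.circuits) (hCt : C.card ≤ t + 1)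
    (ht : t < M.E.card) :
    Nat.card {σ : Fin M.E.card ≃ {x // x ∈ M.E} //
      M.Wins σ C ∧ hitTime (fun i => (σ i : α)) C = t + 1} =
    (((M.E \ C).powersetCard (t + 1 - C.card)).filter
      (fun S => ∀ C' ∈ M.circuits, C' ⊆ S ∪ C → C' = C)).card * C.card *
        (t.factorial * (M.E.card - (t + 1)).factorial) := by
  classical
  rw [Nat.card_eq_fintype_card, Fintype.card_subtype, ← card_product]
  rw [card_eq_sum_card_fiberwise (f := fun σ : Fin M.E.card ≃ {x // x ∈ M.E} =>
    (calledSet (fun i => (σ i : α)) (t + 1) \ C, (σ ⟨t, ht⟩ : α)))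
    (t := ((M.E \ C).powersetCard (t + 1 - C.card)).filter
      (fun S => ∀ C' ∈ M.circuits, C' ⊆ S ∪ C → C' = C) ×ˢ C)]
  · rw [sum_const_nat]
    rintro ⟨S, c⟩ hSc
    simp only [mem_product, mem_filter, mem_powersetCard] at hSc
    obtain ⟨⟨⟨hSE, hScard⟩, hS⟩, hc⟩ := hSc
    have hdisj : Disjoint S C := (subset_sdiff.1 hSE).2
    have hTE : S ∪ C ⊆ M.E :=
      union_subset (hSE.trans sdiff_subset) (M.subset_ground C hC)
    rw [← card_calledSet_eq ht hTE (mem_union_right S hc)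
      (by rw [card_union_of_disjoint hdisj]; lia), Fintype.card_subtype, filter_filter]
    congr 1
    refine filter_congr fun σ _ => ?_
    rw [wins_and_hitTime_eq_succ_iff hC ht, Prod.mk.injEq]
    constructor
    · rintro ⟨⟨-, hsub, -⟩, rfl, h⟩
      exact ⟨(sdiff_union_of_subset hsub).symm, h⟩
    · rintro ⟨h, h'⟩
      rw [h, h', union_sdiff_cancel_right hdisj]
      exact ⟨⟨hS, subset_union_right, hc⟩, rfl, rfl⟩
  · intro σ hσ
    simp only [coe_filter, mem_univ, true_and, Set.mem_ofPred_eq,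
      wins_and_hitTime_eq_succ_iff hC ht] at hσ
    obtain ⟨huniq, hsub, hmem⟩ := hσ
    simp only [mem_coe, mem_product, mem_filter, mem_powersetCard]
    refine ⟨⟨⟨sdiff_subset_sdiff (calledSet_subset_ground σ _) le_rfl, ?_⟩, ?_⟩, hmem⟩
    · rw [card_sdiff_of_subset hsub, card_calledSet (coe_injective σ) ht]
    · rwa [sdiff_union_of_subset hsub]

lemma beta_eq_sum_betaT (hC : C ∈ M.circuits) :
    M.beta C = ∑ t ∈ Finset.Icc C.card (M.rank + 1), M.betaT C t := by
  classical
  simp only [beta, betaT, ← Finset.sum_div, Nat.card_eq_fintype_card, Fintype.card_subtype]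
  rw [card_eq_sum_card_fiberwise (f := fun σ : Fin M.E.card ≃ {x // x ∈ M.E} =>
    hitTime (fun i => (σ i : α)) C) (t := Finset.Icc C.card (M.rank + 1))]
  · simp only [filter_filter]
    push_cast
    rfl
  · intro σ hσ
    simp only [coe_filter, mem_univ, true_and, Set.mem_ofPred_eq] at hσ
    exact mem_coe.2 (mem_Icc.2 ⟨card_le_hitTime σ hC, hσ.hitTime_le hC⟩)

end BingoMatroid

/-- formula for the timed winning probabilities `β_C(t)`, their
vanishing outside `[|C|, r+1]`, and `β_C = ∑_{t=|C|}^{r+1} β_C(t)`. -/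
theorem stmt1 {α : Type*} [DecidableEq α] (M : BingoMatroid α) (hE : M.E.Nonempty)
    (C : Finset α) (hC : C ∈ M.circuits) :
    (∀ t : ℕ, C.card ≤ t → t ≤ M.E.card →
      M.betaT C t = (C.card : ℚ) / (M.E.card : ℚ) *
        ((((M.E \ C).powersetCard (t - C.card)).filter
            (fun S => ∀ C' ∈ M.circuits, C' ⊆ S ∪ C → C' = C)).card : ℚ) *
        (Nat.choose (M.E.card - 1) (t - 1) : ℚ)⁻¹) ∧
    (∀ t : ℕ, t < C.card → M.betaT C t = 0) ∧
    (∀ t : ℕ, M.rank + 1 < t → M.betaT C t = 0) ∧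
    M.beta C = ∑ t ∈ Finset.Icc C.card (M.rank + 1), M.betaT C t := by
  refine ⟨fun t hCt htn => ?_, fun t ht => ?_, fun t ht => ?_, BingoMatroid.beta_eq_sum_betaT hC⟩
  · have hCpos : 0 < C.card :=
      card_pos.2 (nonempty_iff_ne_empty.2 fun h => M.empty_not_mem (h ▸ hC))
    obtain ⟨t, rfl⟩ : ∃ s, t = s + 1 := ⟨t - 1, by lia⟩
    obtain ⟨n, hn⟩ : ∃ n, M.E.card = n + 1 := ⟨M.E.card - 1, by lia⟩
    rw [BingoMatroid.betaT, BingoMatroid.card_wins_and_hitTime_eq_succ hC hCt htn, hn]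
    rw [Nat.add_sub_cancel, Nat.add_sub_cancel, Nat.add_sub_add_right,
      Nat.cast_choose ℚ (show t ≤ n by lia), Nat.factorial_succ]
    push_cast
    have h₁ : (n.factorial : ℚ) ≠ 0 := mod_cast n.factorial_ne_zero
    have h₂ : (t.factorial : ℚ) ≠ 0 := mod_cast t.factorial_ne_zero
    have h₃ : ((n - t).factorial : ℚ) ≠ 0 := mod_cast (n - t).factorial_ne_zero
    field_simp
  · refine BingoMatroid.betaT_eq_zero fun σ _ h => ?_
    have := BingoMatroid.card_le_hitTime σ hC
    lia
  · refine BingoMatroid.betaT_eq_zero fun σ hσ h => ?_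
    have := hσ.hitTime_le hC
    lia
end

section
/- Let M be a matroid on a ground set E of size n and let C be a circuit of M. Then the sequence of timed winning probabilities β_C(1), β_C(2), ..., β_C(n) is log-concave: β_C(t)^2 ≥ β_C(t-1) · β_C(t+1) for every t with 2 ≤ t ≤ n-1. -/
open Finset

section LinearAlgebra
open Matrix

variable {X : Type*} [Fintype X]

theorem dotProduct_mulVec_nonpos_of_eigenvectors [DecidableEq X] {M : Matrix X X ℝ}
    (hM : M.IsHermitian) {e : X → ℝ}
    (h : ∀ (z : X → ℝ) (c : ℝ), 0 < c → M *ᵥ z = c • z → ∃ a : ℝ, z = a • e)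
    {z : X → ℝ} (hz : z ⬝ᵥ e = 0) : z ⬝ᵥ M *ᵥ z ≤ 0 := by
  have key := hM.eigenvectorBasis.sum_inner_mul_inner (WithLp.toLp 2 z) (WithLp.toLp 2 (M *ᵥ z))
  have hzz : inner ℝ (WithLp.toLp 2 z) (WithLp.toLp 2 (M *ᵥ z)) = z ⬝ᵥ M *ᵥ z := by
    simp [EuclideanSpace.inner_toLp_toLp, dotProduct_comm]
  rw [← hzz, ← key]
  refine Finset.sum_nonpos fun i _ => ?_
  set b : X → ℝ := (hM.eigenvectorBasis i).ofLp with hb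
  have hbi : hM.eigenvectorBasis i = WithLp.toLp 2 b := rfl
  have hMb : M *ᵥ b = hM.eigenvalues i • b := hM.mulVec_eigenvectorBasis i
  have hMt : Mᵀ = M := (isHermitian_iff_isSymm.1 hM).eq
  have h1 : b ⬝ᵥ M *ᵥ z = hM.eigenvalues i * (b ⬝ᵥ z) := by
    rw [dotProduct_mulVec, ← mulVec_transpose, hMt, hMb, smul_dotProduct, smul_eq_mul]
  have h2 : inner ℝ (WithLp.toLp 2 z) (hM.eigenvectorBasis i) = b ⬝ᵥ z := by
    rw [hbi]; simp [EuclideanSpace.inner_toLp_toLp]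
  have h3 : inner ℝ (hM.eigenvectorBasis i) (WithLp.toLp 2 (M *ᵥ z)) = b ⬝ᵥ M *ᵥ z := by
    rw [hbi]; simp [EuclideanSpace.inner_toLp_toLp, dotProduct_comm]
  rw [h2, h3, h1]
  rcases le_or_gt (hM.eigenvalues i) 0 with hc | hc
  · nlinarith [sq_nonneg (b ⬝ᵥ z)]
  · obtain ⟨a, ha⟩ := h b _ hc hMb
    rw [ha, smul_dotProduct, dotProduct_comm, hz]
    simp

/-- The reversed Cauchy–Schwarz inequality of a quadratic form against the all-ones vector. -/
def Matrix.HasReverseCauchySchwarz (A : Matrix X X ℝ) : Prop :=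
  ∀ u : X → ℝ, (u ⬝ᵥ A *ᵥ u) * (1 ⬝ᵥ A *ᵥ 1) ≤ (u ⬝ᵥ A *ᵥ 1) ^ 2

theorem sum_mul_sq_sub_dotProduct_mulVec {A : Matrix X X ℝ} (hA : A.IsSymm) (u : X → ℝ) :
    2 * (∑ i, (A *ᵥ 1) i * u i ^ 2 - u ⬝ᵥ A *ᵥ u) = ∑ i, ∑ j, A i j * (u i - u j) ^ 2 := by
  have h1 : ∑ i, (A *ᵥ 1) i * u i ^ 2 = ∑ i, ∑ j, A i j * u i ^ 2 := by
    simp [mulVec, dotProduct, Finset.sum_mul]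
  have h2 : ∑ i, ∑ j, A i j * u i ^ 2 = ∑ i, ∑ j, A i j * u j ^ 2 := by
    rw [Finset.sum_comm]
    refine Finset.sum_congr rfl fun i _ => Finset.sum_congr rfl fun j _ => ?_
    rw [hA.apply]
  have h3 : u ⬝ᵥ A *ᵥ u = ∑ i, ∑ j, A i j * (u i * u j) := by
    simp only [mulVec, dotProduct, Finset.mul_sum]
    refine Finset.sum_congr rfl fun i _ => Finset.sum_congr rfl fun j _ => by ring
  rw [mul_sub, two_mul]
  nth_rewrite 2 [h1]
  rw [h2, h1, h3, Finset.mul_sum, ← Finset.sum_add_distrib, ← Finset.sum_sub_distrib]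
  refine Finset.sum_congr rfl fun i _ => ?_
  rw [Finset.mul_sum, ← Finset.sum_add_distrib, ← Finset.sum_sub_distrib]
  exact Finset.sum_congr rfl fun j _ => by ring

theorem dotProduct_mulVec_symm {A : Matrix X X ℝ} (hA : A.IsSymm) (u v : X → ℝ) :
    u ⬝ᵥ A *ᵥ v = v ⬝ᵥ A *ᵥ u := by
  rw [dotProduct_mulVec, ← mulVec_transpose, hA.eq, dotProduct_comm]

/-- Reversed Cauchy–Schwarz against one positive vector gives it against every
vector on which the form is nonnegative. -/
theorem mul_le_sq_of_mul_le_sq {A : Matrix X X ℝ} (hA : A.IsSymm) {z : X → ℝ}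
    (hz : 0 < z ⬝ᵥ A *ᵥ z)
    (h : ∀ u : X → ℝ, (u ⬝ᵥ A *ᵥ u) * (z ⬝ᵥ A *ᵥ z) ≤ (u ⬝ᵥ A *ᵥ z) ^ 2)
    (u v : X → ℝ) (hv : 0 ≤ v ⬝ᵥ A *ᵥ v) :
    (u ⬝ᵥ A *ᵥ u) * (v ⬝ᵥ A *ᵥ v) ≤ (u ⬝ᵥ A *ᵥ v) ^ 2 := by
  by_contra! hlt
  have hv' : 0 < v ⬝ᵥ A *ᵥ v := lt_of_le_of_ne hv fun h0 => by
    rw [← h0] at hlt; nlinarith [sq_nonneg (u ⬝ᵥ A *ᵥ v)]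
  have hvz := h v
  have hx := h ((v ⬝ᵥ A *ᵥ z) • u - (u ⬝ᵥ A *ᵥ z) • v)
  simp only [mulVec_sub, mulVec_smul, sub_dotProduct, dotProduct_sub, smul_dotProduct,
    dotProduct_smul, smul_eq_mul] at hx
  rw [dotProduct_mulVec_symm hA v u] at hx
  generalize u ⬝ᵥ A *ᵥ u = uu at *
  generalize u ⬝ᵥ A *ᵥ v = uv at *
  generalize v ⬝ᵥ A *ᵥ v = vv at *
  generalize z ⬝ᵥ A *ᵥ z = zz at *
  generalize u ⬝ᵥ A *ᵥ z = uz at *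
  generalize v ⬝ᵥ A *ᵥ z = vz at *
  have h1 : vz ^ 2 * uu - 2 * uz * vz * uv + uz ^ 2 * vv ≤ 0 := by
    by_contra! h0
    nlinarith [mul_pos h0 hz]
  have h2 : (vv * uz - vz * uv) ^ 2 + vz ^ 2 * (uu * vv - uv ^ 2) ≤ 0 := by
    nlinarith [mul_nonneg hv (neg_nonneg.2 h1)]
  have h3 : 0 < vz ^ 2 := lt_of_lt_of_le (mul_pos hv' hz) hvz
  nlinarith [sq_nonneg (vv * uz - vz * uv), mul_pos h3 (sub_pos.2 hlt)]

theorem hasReverseCauchySchwarz_of_forall_nonpos {A : Matrix X X ℝ} (hA : A.IsSymm)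
    (h0 : ∀ i j, 0 ≤ A i j) (h : ∀ u : X → ℝ, u ⬝ᵥ A *ᵥ 1 = 0 → u ⬝ᵥ A *ᵥ u ≤ 0) :
    A.HasReverseCauchySchwarz := by
  intro u
  have hR : 0 ≤ (1 : X → ℝ) ⬝ᵥ A *ᵥ 1 := by
    simp only [dotProduct, mulVec, Pi.one_apply, one_mul, mul_one]
    exact Finset.sum_nonneg fun i _ => Finset.sum_nonneg fun j _ => h0 i j
  rcases hR.eq_or_lt with hR | hR
  · rw [← hR, mul_zero]; positivity
  · have := h (((1 : X → ℝ) ⬝ᵥ A *ᵥ 1) • u - (u ⬝ᵥ A *ᵥ 1) • 1) (by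
      simp only [sub_dotProduct, smul_dotProduct, smul_eq_mul]; ring)
    simp only [mulVec_sub, mulVec_smul, sub_dotProduct, dotProduct_sub, smul_dotProduct,
      dotProduct_smul, smul_eq_mul] at this
    rw [dotProduct_mulVec_symm hA 1 u] at this
    by_contra! hlt
    nlinarith [mul_pos hR (sub_pos.2 hlt)]

/-- A Bochner-type inequality together with a row meeting all nonzero rows forces
hyperbolicity. -/
theorem hasReverseCauchySchwarz_of_bochner {A : Matrix X X ℝ} (hA : A.IsSymm)
    (h0 : ∀ i j, 0 ≤ A i j)
    (y : X) (hy : ∀ i, (A *ᵥ 1) i ≠ 0 → 0 < A i y)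
    (hB : ∀ u : X → ℝ, u ⬝ᵥ A *ᵥ u ≤ ∑ i, (A *ᵥ u) i ^ 2 / (A *ᵥ 1) i) :
    A.HasReverseCauchySchwarz := by
  classical
  set r : X → ℝ := A *ᵥ 1 with hr
  have hrs : ∀ i, r i = ∑ j, A i j := fun i => by simp [hr, mulVec, dotProduct]
  have hr0 : ∀ i, 0 ≤ r i := fun i => by rw [hrs]; exact Finset.sum_nonneg fun j _ => h0 i j
  have hAr : ∀ i j, r i = 0 → A i j = 0 := fun i j hi => by
    rw [hrs, Finset.sum_eq_zero_iff_of_nonneg fun j _ => h0 i j] at hi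
    exact hi j (Finset.mem_univ j)
  have hAr' : ∀ i j, r j = 0 → A i j = 0 := fun i j hj => by rw [← hA.apply]; exact hAr j i hj
  refine hasReverseCauchySchwarz_of_forall_nonpos hA h0 fun u hu => ?_
  set s : X → ℝ := fun i => Real.sqrt (r i) with hs
  have hss : ∀ i, s i * s i = r i := fun i => Real.mul_self_sqrt (hr0 i)
  have hs0 : ∀ i, s i = 0 → r i = 0 := fun i hi => by rw [← hss, hi, zero_mul]
  set M : Matrix X X ℝ := Matrix.of fun i j => (s i)⁻¹ * A i j * (s j)⁻¹ with hMdef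
  have hM : M.IsHermitian := by
    ext i j
    simp only [hMdef, conjTranspose_apply, of_apply, star_trivial]
    rw [hA.apply]; ring
  have hMv : ∀ z i, (M *ᵥ z) i = (s i)⁻¹ * (A *ᵥ fun j => (s j)⁻¹ * z j) i := fun z i => by
    simp only [hMdef, mulVec, dotProduct, of_apply, Finset.mul_sum]
    exact Finset.sum_congr rfl fun j _ => by ring
  have hMz : ∀ z, z ⬝ᵥ M *ᵥ z = (fun j => (s j)⁻¹ * z j) ⬝ᵥ A *ᵥ fun j => (s j)⁻¹ * z j := by
    intro z
    simp only [dotProduct, hMv]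
    exact Finset.sum_congr rfl fun j _ => by ring
  have hmain := dotProduct_mulVec_nonpos_of_eigenvectors hM (e := s) ?_
    (z := fun i => s i * u i) ?_
  · rw [hMz] at hmain
    convert hmain using 1
    simp only [dotProduct, mulVec, Finset.mul_sum]
    refine Finset.sum_congr rfl fun i _ => Finset.sum_congr rfl fun j _ => ?_
    by_cases hi : s i = 0
    · rw [hAr i j (hs0 i hi)]; simp
    by_cases hj : s j = 0
    · rw [hAr' i j (hs0 j hj)]; simp
    field_simp
  · intro z c hc hz
    set v : X → ℝ := fun j => (s j)⁻¹ * z j with hv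
    have hz' : ∀ i, (s i)⁻¹ * (A *ᵥ v) i = c * z i := fun i => by
      rw [← hMv, hz, Pi.smul_apply, smul_eq_mul]
    have hzv : ∀ i, z i = s i * v i := fun i => by
      by_cases hi : s i = 0
      · have := hz' i
        rw [hi, _root_.inv_zero, zero_mul] at this
        rw [hi, zero_mul]
        rcases mul_eq_zero.1 this.symm with h | h
        · exact absurd h hc.ne'
        · exact h
      · simp only [hv]; field_simp
    have hAv : ∀ i, (A *ᵥ v) i = c * (r i * v i) := fun i => by
      by_cases hi : s i = 0
      · rw [hs0 i hi]
        simp only [mulVec, dotProduct, hAr i _ (hs0 i hi)]; simp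
      · have h1 := hz' i
        rw [hzv i] at h1
        rw [← hss i]
        field_simp at h1
        rw [h1]; ring
    set Q : ℝ := ∑ i, r i * v i ^ 2 with hQ
    have hq : v ⬝ᵥ A *ᵥ v = c * Q := by
      simp only [dotProduct, hAv, hQ, Finset.mul_sum]
      exact Finset.sum_congr rfl fun i _ => by ring
    have hb : c * Q ≤ c ^ 2 * Q := by
      rw [← hq]
      refine (hB v).trans_eq ?_
      rw [hQ, Finset.mul_sum]
      refine Finset.sum_congr rfl fun i _ => ?_
      rw [hAv i]
      by_cases hi : r i = 0
      · simp [hi]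
      · field_simp
    have hpf := sum_mul_sq_sub_dotProduct_mulVec hA v
    rw [← hr, ← hQ, hq] at hpf
    have hnn : ∀ i j, 0 ≤ A i j * (v i - v j) ^ 2 := fun i j =>
      mul_nonneg (h0 i j) (sq_nonneg _)
    have hpos : 0 ≤ ∑ i, ∑ j, A i j * (v i - v j) ^ 2 :=
      Finset.sum_nonneg fun i _ => Finset.sum_nonneg fun j _ => hnn i j
    have hzero : ∑ i, ∑ j, A i j * (v i - v j) ^ 2 = 0 := by
      refine le_antisymm ?_ hpos
      rw [← hpf]
      rw [← hpf] at hpos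
      by_contra! hlt
      nlinarith [mul_pos hc hlt]
    refine ⟨v y, funext fun i => ?_⟩
    rw [hzv i, Pi.smul_apply, smul_eq_mul]
    by_cases hi : r i = 0
    · simp [hs, hi]
    · rw [Finset.sum_eq_zero_iff_of_nonneg fun i _ => Finset.sum_nonneg fun j _ => hnn i j] at hzero
      have h1 := hzero i (Finset.mem_univ i)
      rw [Finset.sum_eq_zero_iff_of_nonneg fun j _ => hnn i j] at h1
      have h2 := h1 y (Finset.mem_univ y)
      have h3 : v i = v y := by
        rcases mul_eq_zero.1 h2 with h | h
        · exact absurd h (hy i hi).ne'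
        · exact sub_eq_zero.1 (pow_eq_zero_iff (two_ne_zero) |>.1 h)
      rw [h3, mul_comm]
  · rw [← hu]
    simp only [dotProduct]
    exact Finset.sum_congr rfl fun i _ => by rw [← hr, ← hss i]; ring

end LinearAlgebra

section Polarization
open Matrix Multiset

variable {X : Type*} [Fintype X]

/-- Iterated sums of a function on multisets over all ways of adding `d` elements. -/
def polar (φ : Multiset X → ℝ) : ℕ → Multiset X → ℝ
  | 0, L => φ L
  | d + 1, L => ∑ x, polar φ d (x ::ₘ L)

/-- The Hessian-like matrix of `polar φ d` at `L`. -/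
def polarHessian (φ : Multiset X → ℝ) (d : ℕ) (L : Multiset X) : Matrix X X ℝ :=
  Matrix.of fun x y => polar φ d (x ::ₘ y ::ₘ L)

variable {φ : Multiset X → ℝ}

theorem polar_nonneg (h0 : ∀ L, 0 ≤ φ L) (d : ℕ) (L : Multiset X) : 0 ≤ polar φ d L := by
  induction d generalizing L with
  | zero => exact h0 L
  | succ d ih => exact Finset.sum_nonneg fun x _ => ih _

theorem polar_eq_zero (hd : ∀ x L, φ L = 0 → φ (x ::ₘ L) = 0) (d : ℕ) {L : Multiset X}
    (hL : φ L = 0) : polar φ d L = 0 := by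
  induction d generalizing L with
  | zero => exact hL
  | succ d ih => exact Finset.sum_eq_zero fun x _ => ih (hd x L hL)

theorem polar_pos (h0 : ∀ L, 0 ≤ φ L) {y : X} (hy : ∀ L, 0 < φ L → 0 < φ (y ::ₘ L)) (d : ℕ)
    {L : Multiset X} (hL : 0 < φ L) : 0 < polar φ d L := by
  induction d generalizing L with
  | zero => exact hL
  | succ d ih =>
    exact Finset.sum_pos' (fun x _ => polar_nonneg h0 d _) ⟨y, Finset.mem_univ y, ih (hy L hL)⟩

theorem isSymm_polarHessian (d : ℕ) (L : Multiset X) : (polarHessian φ d L).IsSymm := by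
  ext x y
  simp [polarHessian, Multiset.cons_swap]

theorem polarHessian_mulVec_one (d : ℕ) (L : Multiset X) (x : X) :
    (polarHessian φ d L *ᵥ 1) x = polar φ (d + 1) (x ::ₘ L) := by
  simp [polarHessian, mulVec, dotProduct, polar, Multiset.cons_swap x]

/-- Hyperbolicity of the degree-two polarizations propagates to all degrees. -/
theorem hasReverseCauchySchwarz_polarHessian (h0 : ∀ L, 0 ≤ φ L)
    (hd : ∀ x L, φ L = 0 → φ (x ::ₘ L) = 0)
    (y : X) (hy : ∀ L, 0 < φ L → 0 < φ (y ::ₘ L))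
    (hbase : ∀ L, (polarHessian φ 0 L).HasReverseCauchySchwarz) (d : ℕ) (L : Multiset X) :
    (polarHessian φ d L).HasReverseCauchySchwarz := by
  induction d generalizing L with
  | zero => exact hbase L
  | succ d ih =>
    have hnn : ∀ d L i j, 0 ≤ polarHessian φ d L i j := fun d L i j => polar_nonneg h0 d _
    refine hasReverseCauchySchwarz_of_bochner (isSymm_polarHessian _ _) (hnn _ _) y ?_ ?_
    · intro i hi
      rw [polarHessian_mulVec_one] at hi
      have hφ : 0 < φ (i ::ₘ L) := lt_of_le_of_ne (h0 _) fun h => hi (polar_eq_zero hd _ h.symm)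
      have : 0 < polar φ (d + 1) (y ::ₘ i ::ₘ L) := polar_pos h0 hy _ (hy _ hφ)
      rwa [Multiset.cons_swap] at this
    · intro u
      have hsum : u ⬝ᵥ polarHessian φ (d + 1) L *ᵥ u =
          ∑ z, u ⬝ᵥ polarHessian φ d (z ::ₘ L) *ᵥ u := by
        have : polarHessian φ (d + 1) L = ∑ z, polarHessian φ d (z ::ₘ L) := by
          ext x x'
          simp only [polarHessian, of_apply, Matrix.sum_apply, polar]
          refine Finset.sum_congr rfl fun z _ => ?_
          rw [Multiset.cons_swap z x, Multiset.cons_swap z x']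
        rw [this, Matrix.sum_mulVec, dotProduct_sum]
      rw [hsum]
      refine Finset.sum_le_sum fun z _ => ?_
      have hrow : polarHessian φ d (z ::ₘ L) *ᵥ 1 = fun x => polarHessian φ (d + 1) L x z := by
        ext x; rw [polarHessian_mulVec_one]; rfl
      have htot : (1 : X → ℝ) ⬝ᵥ polarHessian φ d (z ::ₘ L) *ᵥ 1 =
          (polarHessian φ (d + 1) L *ᵥ 1) z := by
        rw [hrow]
        simp only [dotProduct, mulVec, Pi.one_apply, one_mul, mul_one]
        exact Finset.sum_congr rfl fun x _ => (isSymm_polarHessian _ _).apply _ _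
      have hmix : u ⬝ᵥ polarHessian φ d (z ::ₘ L) *ᵥ 1 = (polarHessian φ (d + 1) L *ᵥ u) z := by
        rw [hrow]
        simp only [dotProduct, mulVec]
        refine Finset.sum_congr rfl fun x _ => ?_
        rw [(isSymm_polarHessian _ _).apply, mul_comm]
      have hh := ih (z ::ₘ L) u
      rw [htot, hmix] at hh
      have htot0 : 0 ≤ (polarHessian φ (d + 1) L *ᵥ 1) z := by
        rw [polarHessian_mulVec_one]; exact polar_nonneg h0 _ _
      rcases htot0.eq_or_lt with h | h
      · rw [← h, div_zero]
        rw [← h] at htot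
        simp only [dotProduct, mulVec, Pi.one_apply, one_mul, mul_one] at htot
        rw [Finset.sum_eq_zero_iff_of_nonneg
          fun i _ => Finset.sum_nonneg fun j _ => hnn _ _ i j] at htot
        have hz : polarHessian φ d (z ::ₘ L) = 0 := by
          ext i j
          have h1 := htot i (Finset.mem_univ i)
          rw [Finset.sum_eq_zero_iff_of_nonneg fun j _ => hnn _ _ i j] at h1
          exact h1 j (Finset.mem_univ j)
        rw [hz]; simp
      · rwa [le_div_iff₀ h]

end Polarization

section IndependenceSystem
open Matrix Nat

variable {V : Type*}

theorem nonneg_and_sq_sum_le_card_mul_sum_ite {γ : Type*} [DecidableEq γ] (N : Finset V) (κ : V → γ)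
    (u : V → ℝ) :
    0 ≤ ∑ i ∈ N, ∑ j ∈ N, (if κ i = κ j then u i * u j else 0) ∧
      (∑ i ∈ N, u i) ^ 2 ≤ #N * ∑ i ∈ N, ∑ j ∈ N, if κ i = κ j then u i * u j else 0 := by
  have hmaps : ∀ i ∈ N, κ i ∈ N.image κ := fun i hi => Finset.mem_image_of_mem κ hi
  have hP : ∑ i ∈ N, ∑ j ∈ N, (if κ i = κ j then u i * u j else 0) =
      ∑ c ∈ N.image κ, (∑ i ∈ N with κ i = c, u i) ^ 2 := by
    rw [← Finset.sum_fiberwise_of_maps_to hmaps]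
    refine Finset.sum_congr rfl fun c _ => ?_
    rw [sq, Finset.sum_mul]
    refine Finset.sum_congr rfl fun i hi => ?_
    rw [Finset.mul_sum, Finset.sum_filter]
    refine Finset.sum_congr rfl fun j _ => ?_
    rw [← (Finset.mem_filter.1 hi).2]
    simp only [eq_comm]
  have hnn : 0 ≤ ∑ c ∈ N.image κ, (∑ i ∈ N with κ i = c, u i) ^ 2 :=
    Finset.sum_nonneg fun c _ => sq_nonneg _
  rw [hP, ← Finset.sum_fiberwise_of_maps_to hmaps]
  refine ⟨hnn, ?_⟩
  refine sq_sum_le_card_mul_sum_sq.trans ?_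
  exact mul_le_mul_of_nonneg_right (by exact_mod_cast Finset.card_image_le) hnn

theorem factorial_mul_factorial_mul_le {s : ℕ} {U P : ℝ} (hP0 : 0 ≤ P) (hP : U ^ 2 ≤ s * P) :
    (s ! : ℝ) * ((s - 2)! * (U ^ 2 - P)) ≤ ((s - 1)! * U) ^ 2 := by
  match s with
  | 0 => simpa using (hP.trans (by simp)).trans (add_nonneg (sq_nonneg U) hP0)
  | 1 => simpa using hP0
  | s + 2 =>
    rw [show s + 2 - 2 = s by omega, show s + 2 - 1 = s + 1 by omega, Nat.factorial_succ (s + 1),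
      Nat.factorial_succ s]
    push_cast at hP ⊢
    have h : (s + 1 + 1 : ℝ) * (U ^ 2 - P) ≤ (s + 1) * U ^ 2 := by linarith
    have := mul_le_mul_of_nonneg_left h (by positivity : (0 : ℝ) ≤ (s + 1) * s ! ^ 2)
    linear_combination this

theorem hasReverseCauchySchwarz_of_classes [Fintype V] [DecidableEq V]
    {γ : Type*} [DecidableEq γ] {N : Finset V}
    {κ : V → γ} {s : ℕ} (hs : #N ≤ s) {e ε : ℝ} (he : 0 < e) (hε : 0 < ε)
    {A : Matrix (Option V) (Option V) ℝ} (hA : A.IsSymm)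
    (hnn : A none none = e * ε ^ 2 * s !)
    (hns : ∀ i, A none (some i) = if i ∈ N then e * ε * (s - 1)! else 0)
    (hss : ∀ i j, A (some i) (some j) =
      if i ∈ N ∧ j ∈ N ∧ κ i ≠ κ j then e * (s - 2)! else 0) :
    A.HasReverseCauchySchwarz := by
  have hA0 : ∀ x y, 0 ≤ A x y := by
    have h1 : ∀ i, 0 ≤ A none (some i) := fun i => by rw [hns]; split_ifs <;> positivity
    rintro (_ | i) (_ | j)
    · rw [hnn]; positivity
    · exact h1 j
    · rw [hA.apply]; exact h1 i
    · rw [hss]; split_ifs <;> positivity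
  have hz : (Pi.single none 1 : Option V → ℝ) ⬝ᵥ A *ᵥ Pi.single none 1 = A none none := by
    simp
  have h1 : 0 ≤ (1 : Option V → ℝ) ⬝ᵥ A *ᵥ 1 := by
    simp only [dotProduct, mulVec, Pi.one_apply, one_mul, mul_one]
    exact Finset.sum_nonneg fun i _ => Finset.sum_nonneg fun j _ => hA0 i j
  intro u
  refine mul_le_sq_of_mul_le_sq hA (z := Pi.single none 1) (by rw [hz, hnn]; positivity)
    (fun u => ?_) u 1 h1
  set U := ∑ i ∈ N, u (some i) with hU
  set P := ∑ i ∈ N, ∑ j ∈ N, if κ i = κ j then u (some i) * u (some j) else 0 with hP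
  have huz : u ⬝ᵥ A *ᵥ Pi.single none 1 = e * ε * (ε * s ! * u none + (s - 1)! * U) := by
    rw [dotProduct_mulVec_symm hA, single_dotProduct, one_mul]
    simp only [mulVec, dotProduct, Fintype.sum_option, hnn, hns, ite_mul, zero_mul]
    rw [Finset.sum_ite_mem, Finset.univ_inter, ← Finset.mul_sum]
    ring
  have huu : u ⬝ᵥ A *ᵥ u = e * (ε ^ 2 * s ! * u none ^ 2 + 2 * ε * (s - 1)! * u none * U +
      (s - 2)! * (U ^ 2 - P)) := by
    have hin : ∀ i, A (some i) none = if i ∈ N then e * ε * (s - 1)! else 0 := fun i => by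
      rw [hA.apply, hns]
    have hUP : ∑ i, u (some i) * ∑ j, A (some i) (some j) * u (some j) =
        e * (s - 2)! * (U ^ 2 - P) := by
      have : U ^ 2 - P = ∑ i ∈ N, ∑ j ∈ N, if κ i ≠ κ j then u (some i) * u (some j) else 0 := by
        rw [hU, hP, sq, Finset.sum_mul_sum, ← Finset.sum_sub_distrib]
        refine Finset.sum_congr rfl fun i _ => ?_
        rw [← Finset.sum_sub_distrib]
        refine Finset.sum_congr rfl fun j _ => ?_
        by_cases h : κ i = κ j <;> simp [h]
      rw [this, Finset.mul_sum, ← Finset.sum_subset (Finset.subset_univ N)]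
      · refine Finset.sum_congr rfl fun i hi => ?_
        rw [Finset.mul_sum, Finset.mul_sum, ← Finset.sum_subset (Finset.subset_univ N)]
        · refine Finset.sum_congr rfl fun j hj => ?_
          rw [hss]
          by_cases h : κ i = κ j
          · simp [h]
          · simp only [hi, hj, ne_eq, h, not_false_eq_true, and_self, if_true]; ring
        · intro j _ hj; simp [hss, hj]
      · intro i _ hi; simp [hss, hi]
    have hUn : ∑ i, u (some i) * (A (some i) none * u none) = e * ε * (s - 1)! * u none * U := by
      simp only [hin, ite_mul, zero_mul, mul_ite, mul_zero]
      rw [Finset.sum_ite_mem, Finset.univ_inter, hU, Finset.mul_sum]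
      exact Finset.sum_congr rfl fun i _ => by ring
    have hnU : ∑ i, A none (some i) * u (some i) = e * ε * (s - 1)! * U := by
      simp only [hns, ite_mul, zero_mul]
      rw [Finset.sum_ite_mem, Finset.univ_inter, ← Finset.mul_sum]
    simp only [mulVec, dotProduct, Fintype.sum_option, mul_add, Finset.sum_add_distrib]
    rw [hUP, hUn, hnU, hnn]
    ring
  obtain ⟨hP0, hUP⟩ := nonneg_and_sq_sum_le_card_mul_sum_ite N κ fun i => u (some i)
  have hfac := factorial_mul_factorial_mul_le (s := s) hP0
    (hUP.trans (mul_le_mul_of_nonneg_right (Nat.cast_le.2 hs) hP0))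
  rw [hz, huz, huu, hnn]
  have := mul_le_mul_of_nonneg_left hfac (by positivity : 0 ≤ e ^ 2 * ε ^ 2)
  rw [← hU, ← hP] at this
  linear_combination this

/-- A downward closed family with the local form of the matroid augmentation axiom:
among elements independent over `S`, being parallel over `S` is transitive. -/
structure IsLocallyAugmentable [DecidableEq V] (Ind : Finset V → Prop) : Prop where
  subset : ∀ I J, Ind I → J ⊆ I → Ind J
  augment : ∀ S i j k, i ∉ S → j ∉ S → k ∉ S → i ≠ j → j ≠ k → i ≠ k → Ind (insert j S) →
    Ind (insert i (insert k S)) → Ind (insert i (insert j S)) ∨ Ind (insert j (insert k S))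

open Classical in
/-- The weight `(m - |I|)!` of an independent set `I`, extended by zero to multisets. -/
noncomputable def indepWeight [DecidableEq V] (Ind : Finset V → Prop) (m : ℕ)
    (T : Multiset V) : ℝ :=
  if T.Nodup ∧ Ind T.toFinset then ((m - T.card)! : ℝ) else 0

/-- The homogenized weight: every homogenizing symbol `none` contributes a factor `ε`. -/
noncomputable def homogWeight [DecidableEq V] (Ind : Finset V → Prop) (m : ℕ) (ε : ℝ)
    (L : Multiset (Option V)) : ℝ :=
  ε ^ L.count none * indepWeight Ind m (L.filterMap id)

variable [DecidableEq V] {Ind : Finset V → Prop} {m : ℕ} {ε : ℝ}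

theorem indepWeight_nonneg (T : Multiset V) : 0 ≤ indepWeight Ind m T := by
  unfold indepWeight; split_ifs <;> positivity

theorem indepWeight_ne_zero {T : Multiset V} :
    indepWeight Ind m T ≠ 0 ↔ T.Nodup ∧ Ind T.toFinset := by
  unfold indepWeight
  split_ifs with h
  · simp only [h, and_self, iff_true]; positivity
  · simpa using h

theorem indepWeight_cons_eq_zero (hI : IsLocallyAugmentable Ind) (i : V) {T : Multiset V}
    (hT : indepWeight Ind m T = 0) : indepWeight Ind m (i ::ₘ T) = 0 := by
  by_contra h
  obtain ⟨h1, h2⟩ := indepWeight_ne_zero.1 h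
  refine indepWeight_ne_zero.2 ⟨(Multiset.nodup_cons.1 h1).2, hI.subset _ _ h2 ?_⟩ hT
  simp

theorem homogWeight_cons_none (L : Multiset (Option V)) :
    homogWeight Ind m ε (none ::ₘ L) = ε * homogWeight Ind m ε L := by
  simp [homogWeight, pow_succ]; ring

theorem homogWeight_cons_some (i : V) (L : Multiset (Option V)) :
    homogWeight Ind m ε (some i ::ₘ L) =
      ε ^ L.count none * indepWeight Ind m (i ::ₘ L.filterMap id) := by
  simp [homogWeight]

theorem homogWeight_nonneg (hε : 0 ≤ ε) (L : Multiset (Option V)) : 0 ≤ homogWeight Ind m ε L :=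
  mul_nonneg (pow_nonneg hε _) (indepWeight_nonneg _)

theorem homogWeight_cons_eq_zero (hI : IsLocallyAugmentable Ind) (x : Option V)
    (L : Multiset (Option V)) (hL : homogWeight Ind m ε L = 0) :
    homogWeight Ind m ε (x ::ₘ L) = 0 := by
  cases x with
  | none => rw [homogWeight_cons_none, hL, mul_zero]
  | some i =>
    rw [homogWeight_cons_some]
    rcases mul_eq_zero.1 hL with h | h
    · rw [h, zero_mul]
    · rw [indepWeight_cons_eq_zero hI i h, mul_zero]

theorem hasReverseCauchySchwarz_polarHessian_homogWeight_zero [Fintype V]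
    (hI : IsLocallyAugmentable Ind)
    {G : Finset V} (hG : ∀ I, Ind I → I ⊆ G) (hε : 0 < ε) (L : Multiset (Option V)) :
    (polarHessian (homogWeight Ind #G ε) 0 L).HasReverseCauchySchwarz := by
  classical
  by_cases h0 : homogWeight Ind #G ε L = 0
  · have : polarHessian (homogWeight Ind #G ε) 0 L = 0 := by
      ext x y
      exact homogWeight_cons_eq_zero hI _ _ (homogWeight_cons_eq_zero hI _ _ h0)
    intro u
    simp [this]
  have hL : indepWeight Ind #G (L.filterMap id) ≠ 0 := fun h =>
    h0 (by rw [homogWeight, h, mul_zero])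
  obtain ⟨hT, hS⟩ := indepWeight_ne_zero.1 hL
  generalize hTdef : L.filterMap id = T at hT hS hL
  set S := T.toFinset with hSdef
  have hcard : T.card = #S := (Multiset.toFinset_card_of_nodup hT).symm
  set D : V → V → Prop := fun i j => i ≠ j ∧ Ind (insert i (insert j S)) with hD
  have hDsymm : ∀ i j, D i j → D j i := fun i j h =>
    ⟨h.1.symm, by rw [Finset.insert_comm]; exact h.2⟩
  set N : Finset V := {i | i ∉ S ∧ Ind (insert i S)} with hN
  have hmemN : ∀ i, i ∈ N ↔ i ∉ S ∧ Ind (insert i S) := fun i => by simp [hN]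
  set κ : V → Finset V := fun i => {k ∈ N | ¬ D i k} with hκ
  have hclass : ∀ i ∈ N, ∀ j ∈ N, (κ i ≠ κ j ↔ D i j) := by
    intro i hi j hj
    constructor
    · intro hne
      by_contra hnD
      have key : ∀ i ∈ N, ∀ j ∈ N, ¬ D i j → ∀ k ∈ N, D i k → D j k := by
        intro i hi j hj hij k hk hik
        by_cases e1 : i = j
        · exact e1 ▸ hik
        by_cases e2 : j = k
        · exact absurd (e2 ▸ hik) hij
        rw [hmemN] at hi hj hk
        rcases hI.augment S i j k hi.1 hj.1 hk.1 e1 e2 hik.1 hj.2 hik.2 with h | h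
        · exact absurd ⟨e1, h⟩ hij
        · exact ⟨e2, h⟩
      refine hne (Finset.filter_congr fun k hk => not_congr ⟨?_, ?_⟩)
      · exact key i hi j hj hnD k hk
      · exact key j hj i hi (fun h => hnD (hDsymm _ _ h)) k hk
    · intro h heq
      have : j ∈ κ j := Finset.mem_filter.2 ⟨hj, fun h => h.1 rfl⟩
      rw [← heq] at this
      exact (Finset.mem_filter.1 this).2 h
  have hNs : #N ≤ #G - #S := by
    have hdisj : Disjoint N S := Finset.disjoint_left.2 fun i hi => ((hmemN i).1 hi).1
    have hsub : N ∪ S ⊆ G := by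
      refine Finset.union_subset (fun i hi => ?_) (hG S hS)
      exact hG _ ((hmemN i).1 hi).2 (Finset.mem_insert_self i S)
    have := Finset.card_le_card hsub
    rw [Finset.card_union_of_disjoint hdisj] at this
    omega
  refine hasReverseCauchySchwarz_of_classes (N := N) (κ := κ) hNs
    (e := ε ^ L.count none) (ε := ε) (by positivity) hε (isSymm_polarHessian _ _) ?_ ?_ ?_
  · simp only [polarHessian, polar, of_apply, homogWeight_cons_none]
    rw [homogWeight, hTdef, indepWeight, if_pos ⟨hT, hS⟩, hcard]
    ring
  · intro i
    simp only [polarHessian, polar, of_apply, homogWeight_cons_none]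
    rw [homogWeight_cons_some, hTdef, indepWeight]
    have : ((i ::ₘ T).Nodup ∧ Ind (i ::ₘ T).toFinset) ↔ i ∈ N := by
      rw [hmemN, Multiset.nodup_cons, Multiset.toFinset_cons, hSdef, Multiset.mem_toFinset]
      tauto
    simp only [this, Multiset.card_cons, hcard, Nat.sub_sub]
    split_ifs <;> ring
  · intro i j
    simp only [polarHessian, polar, of_apply]
    rw [homogWeight_cons_some, Multiset.count_cons_of_ne (by simp),
      Multiset.filterMap_cons_some id _ _ rfl,
      hTdef, indepWeight]
    have : ((i ::ₘ j ::ₘ T).Nodup ∧ Ind (i ::ₘ j ::ₘ T).toFinset) ↔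
        i ∈ N ∧ j ∈ N ∧ κ i ≠ κ j := by
      constructor
      · rintro ⟨h1, h2⟩
        simp only [Multiset.nodup_cons, Multiset.mem_cons, not_or] at h1
        simp only [Multiset.toFinset_cons] at h2
        have hi : i ∈ N := (hmemN i).2 ⟨by simpa [hSdef] using h1.1.2, hI.subset _ _ h2
          (Finset.insert_subset_insert _ (Finset.subset_insert _ _))⟩
        have hj : j ∈ N := (hmemN j).2 ⟨by simpa [hSdef] using h1.2.1, hI.subset _ _ h2
          (Finset.subset_insert _ _)⟩
        exact ⟨hi, hj, (hclass i hi j hj).2 ⟨h1.1.1, h2⟩⟩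
      · rintro ⟨hi, hj, hij⟩
        have hDij := (hclass i hi j hj).1 hij
        have hi' := ((hmemN i).1 hi).1
        have hj' := ((hmemN j).1 hj).1
        rw [hSdef, Multiset.mem_toFinset] at hi' hj'
        refine ⟨?_, ?_⟩
        · simp only [Multiset.nodup_cons, Multiset.mem_cons, not_or]
          exact ⟨⟨hDij.1, hi'⟩, hj', hT⟩
        · simpa only [Multiset.toFinset_cons] using hDij.2
    simp only [this, Multiset.card_cons, hcard, Nat.sub_sub]
    split_ifs <;> ring

variable [Fintype V]

theorem polar_homogWeight_cons_none (d : ℕ) (L : Multiset (Option V)) :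
    polar (homogWeight Ind m ε) d (none ::ₘ L) = ε * polar (homogWeight Ind m ε) d L := by
  induction d generalizing L with
  | zero => exact homogWeight_cons_none L
  | succ d ih =>
    simp only [polar, Finset.mul_sum]
    refine Finset.sum_congr rfl fun x _ => ?_
    rw [Multiset.cons_swap, ih]

theorem continuous_polar_homogWeight (d : ℕ) (L : Multiset (Option V)) :
    Continuous fun ε => polar (homogWeight Ind m ε) d L := by
  induction d generalizing L with
  | zero => simp only [polar, homogWeight]; fun_prop
  | succ d ih => exact continuous_finsetSum _ fun x _ => ih _

theorem polar_homogWeight_mul_le (hI : IsLocallyAugmentable Ind)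
    {G : Finset V} (hG : ∀ I, Ind I → I ⊆ G) (d : ℕ) :
    polar (homogWeight Ind #G 0) d 0 * polar (homogWeight Ind #G 0) (d + 2) 0 ≤
      polar (homogWeight Ind #G 0) (d + 1) 0 ^ 2 := by
  have hc := fun d => continuous_polar_homogWeight (Ind := Ind) (m := #G) d 0
  have hpos : ∀ ε ∈ Set.Ioi (0 : ℝ),
      polar (homogWeight Ind #G ε) d 0 * polar (homogWeight Ind #G ε) (d + 2) 0 ≤
        polar (homogWeight Ind #G ε) (d + 1) 0 ^ 2 := by
    intro ε hε
    rw [Set.mem_Ioi] at hε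
    have h := hasReverseCauchySchwarz_polarHessian (homogWeight_nonneg (Ind := Ind) (m := #G) hε.le)
      (homogWeight_cons_eq_zero hI) none
      (fun L hL => by rw [homogWeight_cons_none]; positivity)
      (hasReverseCauchySchwarz_polarHessian_homogWeight_zero hI hG hε) d 0 (Pi.single none 1)
    have h1 : (1 : Option V → ℝ) ⬝ᵥ polarHessian (homogWeight Ind #G ε) d 0 *ᵥ 1 =
        polar (homogWeight Ind #G ε) (d + 2) 0 := by
      simp only [dotProduct, polarHessian_mulVec_one, Pi.one_apply, one_mul]
      rfl
    have h2 : (Pi.single none 1 : Option V → ℝ) ⬝ᵥ polarHessian (homogWeight Ind #G ε) d 0 *ᵥ 1 =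
        ε * polar (homogWeight Ind #G ε) (d + 1) 0 := by
      rw [single_dotProduct, one_mul, polarHessian_mulVec_one, polar_homogWeight_cons_none]
    have h3 : (Pi.single none 1 : Option V → ℝ) ⬝ᵥ
        polarHessian (homogWeight Ind #G ε) d 0 *ᵥ Pi.single none 1 =
        ε * (ε * polar (homogWeight Ind #G ε) d 0) := by
      simp only [mulVec_single_one, single_dotProduct, one_mul]
      simp only [polarHessian, Matrix.col_apply, of_apply, polar_homogWeight_cons_none]
    rw [h1, h2, h3] at h
    refine le_of_mul_le_mul_left ?_ (by positivity : 0 < ε ^ 2)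
    linear_combination h
  have hcl := le_on_closure hpos ((hc d).mul (hc (d + 2))).continuousOn
    ((hc (d + 1)).pow 2).continuousOn
  exact hcl (by rw [closure_Ioi]; exact Set.self_mem_Ici)

open Classical in
theorem polar_homogWeight_zero (hI : IsLocallyAugmentable Ind) (d : ℕ) (S : Finset V) :
    polar (homogWeight Ind m 0) d (S.val.map some) =
      d ! * (m - (#S + d))! * #{I : Finset V | S ⊆ I ∧ #I = #S + d ∧ Ind I} := by
  induction d generalizing S with
  | zero =>
    have h1 : (S.val.map some).filterMap id = S.val := by
      rw [Multiset.filterMap_map]; simp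
    have h2 : (S.val.map some).count none = 0 := by
      rw [Multiset.count_eq_zero]; simp
    have h3 : ({I : Finset V | S ⊆ I ∧ #I = #S + 0 ∧ Ind I} : Finset (Finset V)) =
        if Ind S then {S} else ∅ := by
      ext I
      simp only [Finset.mem_filter, Finset.mem_univ, true_and, add_zero]
      constructor
      · rintro ⟨h, h', h''⟩
        have := Finset.eq_of_subset_of_card_le h h'.le
        subst this
        simp [h'']
      · split_ifs with hS
        · intro h; rw [Finset.mem_singleton] at h; subst h; exact ⟨subset_rfl, rfl, hS⟩
        · simp
    rw [h3]
    simp only [polar, homogWeight, h1, h2, indepWeight, S.nodup, true_and, Finset.val_toFinset]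
    split_ifs <;> simp
  | succ d ih =>
    have hterm : ∀ i, polar (homogWeight Ind m 0) d (some i ::ₘ S.val.map some) =
        d ! * (m - (#S + (d + 1)))! *
          #{I : Finset V | (S ⊆ I ∧ #I = #S + (d + 1) ∧ Ind I) ∧ i ∈ I \ S} := by
      intro i
      by_cases hi : i ∈ S
      · rw [polar_eq_zero (homogWeight_cons_eq_zero hI)]
        · simp [hi]
        · rw [homogWeight_cons_some, Multiset.filterMap_map]
          simp [indepWeight, hi]
      · have := ih (insert i S)
        rw [Finset.insert_val_of_notMem hi, Multiset.map_cons,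
          Finset.card_insert_of_notMem hi] at this
        rw [this, show #S + 1 + d = #S + (d + 1) by ring]
        congr 3
        ext I
        simp only [Finset.mem_filter, Finset.mem_univ, true_and, Finset.insert_subset_iff,
          Finset.mem_sdiff]
        tauto
    have hcount : ∑ i : V, #{I : Finset V | (S ⊆ I ∧ #I = #S + (d + 1) ∧ Ind I) ∧ i ∈ I \ S} =
        (d + 1) * #{I : Finset V | S ⊆ I ∧ #I = #S + (d + 1) ∧ Ind I} := by
      have := Finset.sum_card_bipartiteAbove_eq_sum_card_bipartiteBelow
        (s := (Finset.univ : Finset V))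
        (t := ({I : Finset V | S ⊆ I ∧ #I = #S + (d + 1) ∧ Ind I} : Finset (Finset V)))
        (fun i I => i ∈ I \ S)
      simp only [Finset.bipartiteAbove, Finset.bipartiteBelow, Finset.filter_filter] at this
      rw [this, mul_comm, Finset.sum_const_nat]
      intro I hI
      rw [Finset.mem_filter] at hI
      rw [Finset.filter_mem_eq_inter, Finset.univ_inter, Finset.card_sdiff_of_subset hI.2.1]
      omega
    rw [polar, Fintype.sum_option, polar_homogWeight_cons_none, zero_mul, zero_add]
    simp only [hterm]
    rw [← Finset.mul_sum, ← Nat.cast_sum, hcount, Nat.factorial_succ]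
    push_cast
    ring

open Classical in
/-- Mason's ultra-log-concavity of the numbers of independent sets. -/
theorem card_indep_mul_card_indep_le (hI : IsLocallyAugmentable Ind)
    {G : Finset V} (hG : ∀ I, Ind I → I ⊆ G) (d : ℕ) :
    ((d ! * (#G - d)! * #{I : Finset V | #I = d ∧ Ind I} : ℕ) : ℝ) *
        ((d + 2)! * (#G - (d + 2))! * #{I : Finset V | #I = d + 2 ∧ Ind I} : ℕ) ≤
      (((d + 1)! * (#G - (d + 1))! * #{I : Finset V | #I = d + 1 ∧ Ind I} : ℕ) : ℝ) ^ 2 := by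
  have h := polar_homogWeight_mul_le hI hG d
  have key := fun d => polar_homogWeight_zero (m := #G) hI d ∅
  simp only [Finset.empty_val, Multiset.map_zero, Finset.empty_subset, true_and, Finset.card_empty,
    zero_add] at key
  rw [key, key, key] at h
  exact_mod_cast h

end IndependenceSystem

section Orderings
open Nat

variable {V : Type*} [Fintype V] {n : ℕ}

/-- The set of the first `t` values of an ordering. -/
def initialValues (σ : Fin n ≃ V) (t : ℕ) : Finset V := {v | (σ.symm v : ℕ) < t}

theorem mem_initialValues {σ : Fin n ≃ V} {t : ℕ} {v : V} :
    v ∈ initialValues σ t ↔ (σ.symm v : ℕ) < t := by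
  simp [initialValues]

theorem card_initialValues (σ : Fin n ≃ V) {t : ℕ} (ht : t ≤ n) : #(initialValues σ t) = t := by
  have : initialValues σ t = ({i : Fin n | (i : ℕ) < t} : Finset (Fin n)).map σ.toEmbedding := by
    ext v
    simp only [mem_initialValues, Finset.mem_map, Finset.mem_filter, Finset.mem_univ, true_and,
      Equiv.coe_toEmbedding]
    exact ⟨fun h => ⟨_, h, by simp⟩, by rintro ⟨i, hi, rfl⟩; simpa using hi⟩
  rw [this, Finset.card_map, Fin.card_filter_val_lt, min_eq_right ht]

variable [DecidableEq V]

theorem card_initialValues_eq_mul_choose (hn : Fintype.card V = n) {S : Finset V} :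
    #{σ : Fin n ≃ V | initialValues σ #S = S} * n.choose #S = n ! := by
  have hle : #S ≤ n := hn ▸ Finset.card_le_univ S
  have hmaps : ∀ σ ∈ (Finset.univ : Finset (Fin n ≃ V)),
      initialValues σ #S ∈ Finset.powersetCard #S (Finset.univ : Finset V) := fun σ _ =>
    Finset.mem_powersetCard.2 ⟨Finset.subset_univ _, card_initialValues σ hle⟩
  have htot := Finset.card_eq_sum_card_fiberwise hmaps
  have heq : ∀ T ∈ Finset.powersetCard #S (Finset.univ : Finset V),
      #{σ : Fin n ≃ V | initialValues σ #S = T} = #{σ : Fin n ≃ V | initialValues σ #S = S} := by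
    intro T hT
    have hcard : Fintype.card {v // v ∈ T} = Fintype.card {v // v ∈ S} := by
      simpa using (Finset.mem_powersetCard.1 hT).2
    let π : Equiv.Perm V := (Fintype.equivOfCardEq hcard).extendSubtype
    have hπ : ∀ v, π v ∈ S ↔ v ∈ T := fun v => by
      by_cases hv : v ∈ T
      · simp only [hv, iff_true]; exact Equiv.extendSubtype_mem _ v hv
      · simp only [hv, iff_false]; exact Equiv.extendSubtype_not_mem _ v hv
    refine Finset.card_equiv (Equiv.equivCongr (Equiv.refl _) π) fun σ => ?_
    simp only [Finset.mem_filter, Finset.mem_univ, true_and, Finset.ext_iff, mem_initialValues]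
    constructor
    · intro h v
      have := h (π.symm v)
      rw [← hπ] at this
      simpa using this
    · intro h v
      have := h (π v)
      rw [hπ] at this
      simpa using this
  rw [Finset.sum_congr rfl heq, Finset.sum_const, Finset.card_powersetCard, Finset.card_univ,
    Finset.card_univ, hn, smul_eq_mul, mul_comm] at htot
  rw [← htot, Fintype.card_equiv (finCongr hn.symm |>.trans (Fintype.equivFin V).symm)]
  simp

theorem card_initialValues_last_mem (P : Finset V → Prop) [DecidablePred P] {C : Finset V}
    (hP : ∀ S, P S → C ⊆ S) {s : ℕ} (hs : s < n) :
    (s + 1) * #{σ : Fin n ≃ V | P (initialValues σ (s + 1)) ∧ σ ⟨s, hs⟩ ∈ C} =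
      #C * #{σ : Fin n ≃ V | P (initialValues σ (s + 1))} := by
  have hswap : ∀ j ∈ ({j : Fin n | (j : ℕ) < s + 1} : Finset (Fin n)),
      #{σ : Fin n ≃ V | P (initialValues σ (s + 1)) ∧ σ j ∈ C} =
        #{σ : Fin n ≃ V | P (initialValues σ (s + 1)) ∧ σ ⟨s, hs⟩ ∈ C} := by
    intro j hj
    have hj' : (j : ℕ) < s + 1 := by simpa using hj
    refine Finset.card_equiv (Equiv.equivCongr (Equiv.swap j ⟨s, hs⟩) (Equiv.refl _)) fun σ => ?_
    have h1 : initialValues ((Equiv.swap j ⟨s, hs⟩).equivCongr (Equiv.refl V) σ) (s + 1) =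
        initialValues σ (s + 1) := by
      ext v
      simp only [mem_initialValues]
      simp only [Equiv.symm_symm, Equiv.equivCongr,
        Equiv.coe_fn_mk, Equiv.symm_trans_apply, Equiv.refl_symm, Equiv.refl_apply]
      rw [Equiv.swap_apply_def]
      split_ifs with h1 h2
      · rw [h1]; simp [hj']
      · rw [h2]; simp [hj']
      · rfl
    simp [h1]
  have hdc := Finset.sum_card_bipartiteAbove_eq_sum_card_bipartiteBelow
    (s := ({j : Fin n | (j : ℕ) < s + 1} : Finset (Fin n)))
    (t := ({σ | P (initialValues σ (s + 1))} : Finset (Fin n ≃ V))) (fun j σ => σ j ∈ C)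
  simp only [Finset.bipartiteAbove, Finset.bipartiteBelow, Finset.filter_filter] at hdc
  rw [Finset.sum_congr rfl hswap, Finset.sum_const, Fin.card_filter_val_lt,
    min_eq_right (by omega : s + 1 ≤ n), smul_eq_mul] at hdc
  rw [hdc, mul_comm, Finset.sum_const_nat]
  intro σ hσ
  have hsub := hP _ (Finset.mem_filter.1 hσ).2
  rw [← Finset.card_map σ.symm.toEmbedding (s := C)]
  congr 1
  ext j
  simp only [Finset.mem_filter, Finset.mem_univ, true_and, Finset.mem_map_equiv, Equiv.symm_symm]
  refine and_iff_right_of_imp fun h => ?_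
  simpa [mem_initialValues] using hsub h

/-- The number of orderings whose first `s + 1` values form a set of the family `P`, the last of
them lying in `C`. -/
theorem card_orderings (hn : Fintype.card V = n) (P : Finset V → Prop) [DecidablePred P]
    {C : Finset V} (hP : ∀ S, P S → C ⊆ S) {s : ℕ} (hs : s < n) :
    #{σ : Fin n ≃ V | P (initialValues σ (s + 1)) ∧ σ ⟨s, hs⟩ ∈ C} =
      #C * #{S : Finset V | #S = s + 1 ∧ P S} * s ! * (n - (s + 1))! := by
  have h1 := card_initialValues_last_mem P hP hs
  have h2 : #{σ : Fin n ≃ V | P (initialValues σ (s + 1))} * n.choose (s + 1) =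
      #{S : Finset V | #S = s + 1 ∧ P S} * n ! := by
    have hmaps : ∀ σ ∈ ({σ | P (initialValues σ (s + 1))} : Finset (Fin n ≃ V)),
        initialValues σ (s + 1) ∈ ({S | #S = s + 1 ∧ P S} : Finset (Finset V)) := fun σ hσ => by
      simpa [card_initialValues σ hs] using hσ
    rw [Finset.card_eq_sum_card_fiberwise hmaps, Finset.sum_mul, Finset.sum_const_nat]
    intro S hS
    obtain ⟨hS1, hS2⟩ := (Finset.mem_filter.1 hS).2
    rw [← card_initialValues_eq_mul_choose hn (S := S), hS1, Finset.filter_filter]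
    congr 2
    ext σ
    simp only [Finset.mem_filter, Finset.mem_univ, true_and, and_iff_right_iff_imp]
    rintro rfl
    exact hS2
  have h3 := Nat.choose_mul_factorial_mul_factorial (show s + 1 ≤ n from hs)
  have hpos : 0 < (s + 1) * n.choose (s + 1) := Nat.mul_pos s.succ_pos (Nat.choose_pos hs)
  refine Nat.eq_of_mul_eq_mul_left hpos ?_
  calc _ = n.choose (s + 1) *
        ((s + 1) * #{σ : Fin n ≃ V | P (initialValues σ (s + 1)) ∧ σ ⟨s, hs⟩ ∈ C}) := by ring
    _ = #C * (#{σ : Fin n ≃ V | P (initialValues σ (s + 1))} * n.choose (s + 1)) := by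
        rw [h1]; ring
    _ = _ := by rw [h2, ← h3, Nat.factorial_succ]; ring

end Orderings

namespace BingoMatroid
open Nat

variable {α : Type*} [DecidableEq α] (M : BingoMatroid α)

theorem strong_elimination {C₁ C₂ : Finset α} (h₁ : C₁ ∈ M.circuits) (h₂ : C₂ ∈ M.circuits)
    {e f : α} (he₁ : e ∈ C₁) (he₂ : e ∈ C₂) (hf₁ : f ∈ C₁) (hf₂ : f ∉ C₂) :
    ∃ C₃ ∈ M.circuits, f ∈ C₃ ∧ C₃ ⊆ (C₁ ∪ C₂) \ {e} := by
  induction hm : #(C₁ ∪ C₂) using Nat.strong_induction_on generalizing C₁ C₂ e f with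
  | _ m ih =>
    subst hm
    have hne : C₁ ≠ C₂ := fun h => hf₂ (h ▸ hf₁)
    obtain ⟨C₃, h₃, hsub⟩ := M.elimination C₁ h₁ C₂ h₂ hne e (Finset.mem_inter.2 ⟨he₁, he₂⟩)
    by_cases hf₃ : f ∈ C₃
    · exact ⟨C₃, h₃, hf₃, hsub⟩
    have he₃ : e ∉ C₃ := fun h => by simpa using hsub h
    have hsub' : C₃ ⊆ C₁ ∪ C₂ := hsub.trans Finset.sdiff_subset
    obtain ⟨g, hg₃, hg₁⟩ : ∃ g ∈ C₃, g ∉ C₁ := by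
      by_contra! h
      exact he₃ (M.antichain C₃ h₃ C₁ h₁ h ▸ he₁)
    have hg₂ : g ∈ C₂ := (Finset.mem_union.1 (hsub' hg₃)).resolve_left hg₁
    have hlt₁ : #(C₂ ∪ C₃) < #(C₁ ∪ C₂) := by
      refine Finset.card_lt_card (Finset.ssubset_iff_of_subset
        (Finset.union_subset Finset.subset_union_right hsub') |>.2 ⟨f, ?_, ?_⟩)
      · exact Finset.mem_union_left _ hf₁
      · simp [hf₂, hf₃]
    obtain ⟨C₄, h₄, he₄, hsub₄⟩ := ih _ hlt₁ h₂ h₃ hg₂ hg₃ he₂ he₃ rfl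
    have hg₄ : g ∉ C₄ := fun h => by simpa using hsub₄ h
    have hsub₄' : C₄ ⊆ C₂ ∪ C₃ := hsub₄.trans Finset.sdiff_subset
    have hf₄ : f ∉ C₄ := fun h => by simpa [hf₂, hf₃] using hsub₄' h
    have hsub₁₄ : C₁ ∪ C₄ ⊆ C₁ ∪ C₂ := Finset.union_subset Finset.subset_union_left
      (hsub₄'.trans (Finset.union_subset Finset.subset_union_right hsub'))
    have hlt₂ : #(C₁ ∪ C₄) < #(C₁ ∪ C₂) := by
      refine Finset.card_lt_card (Finset.ssubset_iff_of_subset hsub₁₄ |>.2 ⟨g, ?_, ?_⟩)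
      · exact Finset.mem_union_right _ hg₂
      · simp [hg₁, hg₄]
    obtain ⟨C₅, h₅, hf₅, hsub₅⟩ := ih _ hlt₂ h₁ h₄ he₁ he₄ hf₁ hf₄ rfl
    exact ⟨C₅, h₅, hf₅, hsub₅.trans (Finset.sdiff_subset_sdiff hsub₁₄ subset_rfl)⟩

/-- A set of elements of the ground set, viewed in the subtype. -/
def inGround (D : Finset α) : Finset {x // x ∈ M.E} := D.subtype (· ∈ M.E)

variable {M} in
theorem mem_inGround {D : Finset α} {x : {x // x ∈ M.E}} :
    x ∈ M.inGround D ↔ (x : α) ∈ D := Finset.mem_subtype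

theorem card_inGround {D : Finset α} (hD : D ⊆ M.E) : #(M.inGround D) = #D := by
  rw [inGround, Finset.card_subtype, Finset.filter_true_of_mem hD]

/-- `C` is the only circuit contained in `S`, if any. -/
def NoOtherCircuit (C : Finset α) (S : Finset {x // x ∈ M.E}) : Prop :=
  ∀ D ∈ M.circuits, M.inGround D ⊆ S → D = C

/-- Independence in the contraction of `M` by the circuit `C`. -/
def ContractIndep (C : Finset α) (I : Finset {x // x ∈ M.E}) : Prop :=
  Disjoint I (M.inGround C) ∧ M.NoOtherCircuit C (I ∪ M.inGround C)

theorem isLocallyAugmentable_contractIndep (C : Finset α) :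
    IsLocallyAugmentable (M.ContractIndep C) where
  subset I J hI hJ := ⟨hI.1.mono_left hJ, fun D hD h =>
    hI.2 D hD (h.trans (Finset.union_subset_union hJ subset_rfl))⟩
  augment S i j k hi hj hk hij hjk hik hIj hIik := by
    have hdisj : ∀ x, x ∈ S ∨ x = i ∨ x = j ∨ x = k → x ∉ M.inGround C := by
      intro x hx
      have h1 : x ∈ insert j S → x ∉ M.inGround C := fun h => Finset.disjoint_left.1 hIj.1 h
      have h2 : x ∈ insert i (insert k S) → x ∉ M.inGround C := fun h =>
        Finset.disjoint_left.1 hIik.1 h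
      simp only [Finset.mem_insert] at h1 h2
      tauto
    have hd : ∀ I : Finset {x // x ∈ M.E}, (∀ x ∈ I, x ∈ S ∨ x = i ∨ x = j ∨ x = k) →
        Disjoint I (M.inGround C) := fun I h =>
      Finset.disjoint_left.2 fun x hx => hdisj x (h x hx)
    by_contra! hcon
    obtain ⟨hcon₁, hcon₂⟩ := hcon
    have hbad : ∀ I : Finset {x // x ∈ M.E}, ¬ M.ContractIndep C I →
        (∀ x ∈ I, x ∈ S ∨ x = i ∨ x = j ∨ x = k) →
        ∃ D ∈ M.circuits, M.inGround D ⊆ I ∪ M.inGround C ∧ D ≠ C := by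
      intro I hI hx
      by_contra! h
      exact hI ⟨hd I hx, h⟩
    obtain ⟨D₁, hD₁, hs₁, hn₁⟩ := hbad _ hcon₁ (by simp only [Finset.mem_insert]; tauto)
    obtain ⟨D₂, hD₂, hs₂, hn₂⟩ := hbad _ hcon₂ (by simp only [Finset.mem_insert]; tauto)
    have hj₁ : j ∈ M.inGround D₁ := by
      by_contra h
      refine hn₁ (hIik.2 D₁ hD₁ fun x hx => ?_)
      have := hs₁ hx
      have hxj : x ≠ j := fun e => h (e ▸ hx)
      grind
    have hi₁ : i ∈ M.inGround D₁ := by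
      by_contra h
      refine hn₁ (hIj.2 D₁ hD₁ fun x hx => ?_)
      have := hs₁ hx
      have hxi : x ≠ i := fun e => h (e ▸ hx)
      grind
    have hj₂ : j ∈ M.inGround D₂ := by
      by_contra h
      refine hn₂ (hIik.2 D₂ hD₂ fun x hx => ?_)
      have := hs₂ hx
      have hxj : x ≠ j := fun e => h (e ▸ hx)
      grind
    have hi₂ : i ∉ M.inGround D₂ := fun h => by
      have := hs₂ h
      have hiC := hdisj i (by tauto)
      simp only [Finset.mem_union, Finset.mem_insert] at this
      tauto
    obtain ⟨D₃, hD₃, hi₃, hs₃⟩ := M.strong_elimination hD₁ hD₂ (mem_inGround.1 hj₁)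
      (mem_inGround.1 hj₂) (mem_inGround.1 hi₁) (fun h => hi₂ (mem_inGround.2 h))
    have hD₃C : D₃ = C := hIik.2 D₃ hD₃ fun x hx => by
      have h3 := hs₃ (mem_inGround.1 hx)
      rw [Finset.mem_sdiff, Finset.mem_union, Finset.mem_singleton] at h3
      have hxj : x ≠ j := fun e => h3.2 (e ▸ rfl)
      rcases h3.1 with h | h
      · have := hs₁ (mem_inGround.2 h)
        grind
      · have := hs₂ (mem_inGround.2 h)
        grind
    exact hdisj i (by tauto) (mem_inGround.2 (hD₃C ▸ hi₃))

theorem hitTime_le_iff (σ : Fin M.E.card ≃ {x // x ∈ M.E}) {D : Finset α} (hD : D ⊆ M.E) (t : ℕ) :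
    hitTime (fun i => (σ i : α)) D ≤ t ↔ M.inGround D ⊆ initialValues σ t := by
  constructor
  · intro h x hx
    have hmem : hitTime (fun i => (σ i : α)) D ∈
        {t : ℕ | ∀ x ∈ D, ∃ i : Fin M.E.card, (i : ℕ) < t ∧ (σ i : α) = x} :=
      Nat.sInf_mem ⟨M.E.card, fun x hx => ⟨σ.symm ⟨x, hD hx⟩, Fin.is_lt _, by simp⟩⟩
    obtain ⟨i, hi, hix⟩ := hmem x (mem_inGround.1 hx)
    have : σ.symm x = i := by rw [Equiv.symm_apply_eq]; exact Subtype.ext hix.symm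
    rw [mem_initialValues, this]
    exact hi.trans_le h
  · intro h
    refine Nat.sInf_le fun x hx => ⟨σ.symm ⟨x, hD hx⟩, ?_, by simp⟩
    exact mem_initialValues.1 (h (mem_inGround.2 hx))

theorem wins_and_hitTime_iff (σ : Fin M.E.card ≃ {x // x ∈ M.E}) {C : Finset α}
    (hC : C ∈ M.circuits) {s : ℕ} (hs : s < M.E.card) :
    M.Wins σ C ∧ hitTime (fun i => (σ i : α)) C = s + 1 ↔
      (M.inGround C ⊆ initialValues σ (s + 1) ∧ M.NoOtherCircuit C (initialValues σ (s + 1))) ∧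
        σ ⟨s, hs⟩ ∈ M.inGround C := by
  have hCE := M.subset_ground C hC
  constructor
  · rintro ⟨hw, ht⟩
    have hsub := (M.hitTime_le_iff σ hCE (s + 1)).1 ht.le
    refine ⟨⟨hsub, fun D hD hDs => ?_⟩, ?_⟩
    · by_contra hne
      have h1 := hw D hD hne
      have h2 := (M.hitTime_le_iff σ (M.subset_ground D hD) _).2 hDs
      omega
    · have hns : ¬ M.inGround C ⊆ initialValues σ s := fun h => by
        have := (M.hitTime_le_iff σ hCE s).2 h
        omega
      obtain ⟨x, hx, hxs⟩ := Finset.not_subset.1 hns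
      have h1 := mem_initialValues.1 (hsub hx)
      rw [mem_initialValues] at hxs
      have : (⟨s, hs⟩ : Fin M.E.card) = σ.symm x := Fin.ext (by simp only; omega)
      rw [this, Equiv.apply_symm_apply]
      exact hx
  · rintro ⟨⟨hsub, hno⟩, hlast⟩
    have hle := (M.hitTime_le_iff σ hCE (s + 1)).2 hsub
    have hnle : ¬ hitTime (fun i => (σ i : α)) C ≤ s := fun h => by
      have := mem_initialValues.1 ((M.hitTime_le_iff σ hCE s).1 h hlast)
      simp at this
    refine ⟨fun D hD hne => ?_, by omega⟩
    have : ¬ hitTime (fun i => (σ i : α)) D ≤ s + 1 := fun h =>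
      hne (hno D hD ((M.hitTime_le_iff σ (M.subset_ground D hD) _).1 h))
    omega

open Classical in
theorem card_contractIndep {C : Finset α} (hC : C ∈ M.circuits) (d : ℕ) :
    #{I | #I = d ∧ M.ContractIndep C I} =
      #{S | #S = d + #C ∧ M.inGround C ⊆ S ∧ M.NoOtherCircuit C S} := by
  have hcard := M.card_inGround (M.subset_ground C hC)
  refine Finset.card_nbij' (· ∪ M.inGround C) (· \ M.inGround C) ?_ ?_ ?_ ?_
  · intro I hI
    simp only [Finset.coe_filter, Finset.mem_univ, true_and, Set.mem_ofPred_eq] at hI ⊢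
    rw [Finset.card_union_of_disjoint hI.2.1, hI.1, hcard]
    exact ⟨rfl, Finset.subset_union_right, hI.2.2⟩
  · intro S hS
    simp only [Finset.coe_filter, Finset.mem_univ, true_and, Set.mem_ofPred_eq] at hS ⊢
    refine ⟨?_, Finset.sdiff_disjoint, ?_⟩
    · rw [Finset.card_sdiff_of_subset hS.2.1, hS.1, hcard]; omega
    · rw [Finset.sdiff_union_of_subset hS.2.1]; exact hS.2.2
  · intro I hI
    simp only [Finset.coe_filter, Finset.mem_univ, true_and, Set.mem_ofPred_eq] at hI
    simp only
    rw [Finset.union_sdiff_right, Finset.sdiff_eq_self_of_disjoint hI.2.1]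
  · intro S hS
    simp only [Finset.coe_filter, Finset.mem_univ, true_and, Set.mem_ofPred_eq] at hS
    exact Finset.sdiff_union_of_subset hS.2.1

open Classical in
theorem betaT_succ {C : Finset α} (hC : C ∈ M.circuits) {s : ℕ} (hs : s < M.E.card) :
    M.betaT C (s + 1) = (#C * #{S | #S = s + 1 ∧ M.inGround C ⊆ S ∧ M.NoOtherCircuit C S} *
      s ! * (M.E.card - (s + 1))! : ℕ) / (M.E.card ! : ℚ) := by
  rw [betaT, ← M.card_inGround (M.subset_ground C hC),
    ← card_orderings (by simp) (fun S => M.inGround C ⊆ S ∧ M.NoOtherCircuit C S)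
      (fun S h => h.1) hs, Nat.card_eq_fintype_card, Fintype.card_subtype]
  simp only [M.wins_and_hitTime_iff _ hC hs]

end BingoMatroid

/-- the sequence `β_C(1), ..., β_C(n)` of timed winning
probabilities is log-concave. -/
theorem stmt3 {α : Type*} [DecidableEq α] (M : BingoMatroid α) (hE : M.E.Nonempty)
    (C : Finset α) (hC : C ∈ M.circuits)
    (t : ℕ) (ht1 : 2 ≤ t) (ht2 : t ≤ M.E.card - 1) :
    M.betaT C (t - 1) * M.betaT C (t + 1) ≤ M.betaT C t ^ 2 := by
  classical
  obtain ⟨s, rfl⟩ : ∃ s, t = s + 2 := ⟨t - 2, by omega⟩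
  rw [show s + 2 - 1 = s + 1 by omega, M.betaT_succ hC (s := s) (by omega),
    M.betaT_succ hC (s := s + 2) (by omega), M.betaT_succ hC (s := s + 1) (by omega),
    div_mul_div_comm, div_pow, ← sq]
  refine div_le_div_of_nonneg_right ?_ (by positivity)
  norm_cast
  have hCE := M.subset_ground C hC
  have hk : 0 < #C := Finset.card_pos.2 (Finset.nonempty_iff_ne_empty.2 fun h =>
    M.empty_not_mem (h ▸ hC))
  rcases lt_or_ge (s + 1) #C with hlt | hge
  · have : #{S | #S = s + 1 ∧ M.inGround C ⊆ S ∧ M.NoOtherCircuit C S} = 0 := by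
      rw [Finset.card_eq_zero, Finset.filter_eq_empty_iff]
      rintro S - ⟨h1, h2, -⟩
      have := Finset.card_le_card h2
      rw [M.card_inGround hCE] at this
      omega
    rw [this]
    simp
  obtain ⟨d, hd⟩ : ∃ d, s + 1 = d + #C := ⟨s + 1 - #C, by omega⟩
  have hG : #(Finset.univ \ M.inGround C) = M.E.card - #C := by
    rw [Finset.card_sdiff_of_subset (Finset.subset_univ _), M.card_inGround hCE]; simp
  have h := card_indep_mul_card_indep_le (M.isLocallyAugmentable_contractIndep C)
    (G := Finset.univ \ M.inGround C)
    (fun I hI x hx => Finset.mem_sdiff.2 ⟨Finset.mem_univ x, Finset.disjoint_left.1 hI.1 hx⟩) d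
  simp only [M.card_contractIndep hC, hG] at h
  rw [show d + #C = s + 1 by omega, show d + 2 + #C = s + 2 + 1 by omega,
    show d + 1 + #C = s + 1 + 1 by omega,
    show M.E.card - #C - d = M.E.card - (s + 1) by omega,
    show M.E.card - #C - (d + 2) = M.E.card - (s + 2 + 1) by omega,
    show M.E.card - #C - (d + 1) = M.E.card - (s + 1 + 1) by omega] at h
  norm_cast at h
  have hds : d ≤ s := by omega
  generalize #{S | #S = s + 1 ∧ M.inGround C ⊆ S ∧ M.NoOtherCircuit C S} = F₁ at *
  generalize #{S | #S = s + 1 + 1 ∧ M.inGround C ⊆ S ∧ M.NoOtherCircuit C S} = F₂ at *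
  generalize #{S | #S = s + 2 + 1 ∧ M.inGround C ⊆ S ∧ M.NoOtherCircuit C S} = F₃ at *
  generalize (M.E.card - (s + 1)).factorial = f₁ at *
  generalize (M.E.card - (s + 1 + 1)).factorial = f₂ at *
  generalize (M.E.card - (s + 2 + 1)).factorial = f₃ at *
  have h' : (d + 2) * (f₁ * F₁ * (f₃ * F₃)) ≤ (d + 1) * (f₂ * F₂) ^ 2 := by
    refine Nat.le_of_mul_le_mul_left ?_ (by positivity : 0 < d.factorial ^ 2 * (d + 1))
    simp only [Nat.factorial_succ] at h
    linarith
  have h'' : (s + 2) * (f₁ * F₁ * (f₃ * F₃)) ≤ (s + 1) * (f₂ * F₂) ^ 2 := by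
    refine Nat.le_of_mul_le_mul_left ?_ (by positivity : 0 < d + 1)
    have hc : (d + 1) * (s + 2) ≤ (s + 1) * (d + 2) := by nlinarith
    have h1 := Nat.mul_le_mul_right (f₁ * F₁ * (f₃ * F₃)) hc
    have h2 := Nat.mul_le_mul_left (s + 1) h'
    linarith
  have h3 := Nat.mul_le_mul_left (#C ^ 2 * s.factorial ^ 2 * (s + 1)) h''
  simp only [Nat.factorial_succ]
  linarith
end
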